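/- For all 1 < p, q < ∞ with p ≠ q, the Banach spaces L_p + L_q on (0, ∞) and L_p ∩ L_q on (0, ∞) are not isomorphic. -/

import Mathlib

open MeasureTheory ENNReal

noncomputable section

/-- Lebesgue measure on the half-line `(0, ∞)`. -/
def m0 : MeasureTheory.Measure ℝ := MeasureTheory.volume.restrict (Set.Ioi 0)

/-- The space `L_p + L_q` on `(0, ∞)`, realized as the submodule of (a.e.-equivalence classes
of) measurable functions that are sums of an `L_p` and an `L_q` function. -/
def sumSpace (p q : ℝ≥0∞) : Submodule ℝ (ℝ →ₘ[m0] ℝ) :=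
  Lp.LpSubmodule ℝ ℝ p m0 ⊔ Lp.LpSubmodule ℝ ℝ q m0

/-- The space `L_p ∩ L_q` on `(0, ∞)`, realized as the submodule of (a.e.-equivalence classes
of) measurable functions that belong to both `L_p` and `L_q`. -/
def interSpace (p q : ℝ≥0∞) : Submodule ℝ (ℝ →ₘ[m0] ℝ) :=
  Lp.LpSubmodule ℝ ℝ p m0 ⊓ Lp.LpSubmodule ℝ ℝ q m0

/-- The natural norm on `L_p + L_q`:  `‖f‖ = inf { ‖u‖_p + ‖v‖_q : f = u + v }`
(with value `∞` outside of the space). -/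
def sumNormE (p q : ℝ≥0∞) (f : ℝ →ₘ[m0] ℝ) : ℝ≥0∞ :=
  ⨅ (u : Lp ℝ p m0) (v : Lp ℝ q m0)
    (_ : f = (u : ℝ →ₘ[m0] ℝ) + (v : ℝ →ₘ[m0] ℝ)),
      eLpNorm (u : ℝ → ℝ) p m0 + eLpNorm (v : ℝ → ℝ) q m0

/-- The natural norm on `L_p ∩ L_q`:  `‖f‖ = max (‖f‖_p, ‖f‖_q)`. -/
def interNormE (p q : ℝ≥0∞) (f : ℝ →ₘ[m0] ℝ) : ℝ≥0∞ :=
  max (eLpNorm (f : ℝ → ℝ) p m0) (eLpNorm (f : ℝ → ℝ) q m0)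

/-- `L_p + L_q` and `L_p ∩ L_q` are isomorphic as Banach spaces: there is a linear bijection
between them which, together with its inverse, is bounded. -/
def SumInterIsomorphic (p q : ℝ≥0∞) : Prop :=
  ∃ T : sumSpace p q ≃ₗ[ℝ] interSpace p q, ∃ C : ℝ≥0∞, 0 < C ∧ C < ∞ ∧
    ∀ f : sumSpace p q,
      interNormE p q ((T f : ℝ →ₘ[m0] ℝ)) ≤ C * sumNormE p q (f : ℝ →ₘ[m0] ℝ) ∧
      sumNormE p q (f : ℝ →ₘ[m0] ℝ) ≤ C * interNormE p q ((T f : ℝ →ₘ[m0] ℝ))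



def sgn (b : Bool) : ℝ := if b then 1 else -1

lemma sgn_sq (b : Bool) : sgn b * sgn b = 1 := by cases b <;> simp [sgn]
lemma sgn_abs (b : Bool) : |sgn b| = 1 := by cases b <;> simp [sgn]

lemma sum_exp_sgn (N : ℕ) (a : Fin N → ℝ) :
    ∑ e : Fin N → Bool, Real.exp (∑ k, sgn (e k) * a k) ≤ 2 ^ N * Real.exp ((∑ k, a k ^ 2) / 2) := by
  have h1 : ∑ e : Fin N → Bool, Real.exp (∑ k, sgn (e k) * a k)
      = ∏ k : Fin N, ∑ b : Bool, Real.exp (sgn b * a k) := by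
    rw [Finset.prod_univ_sum]
    simp only [Real.exp_sum]
    refine Finset.sum_congr ?_ fun _ _ => rfl
    ext e; simp [Fintype.mem_piFinset]
  rw [h1, Finset.sum_div, Real.exp_sum]
  have : (2:ℝ) ^ N = ∏ k : Fin N, (2:ℝ) := by simp
  rw [this, ← Finset.prod_mul_distrib]
  apply Finset.prod_le_prod
  · intro i _; positivity
  · intro i _
    have := Real.cosh_le_exp_half_sq (a i)
    rw [Real.cosh_eq] at this
    simp [sgn]
    linarith

lemma abs_rpow_le_exp (q : ℝ) (hq : 0 < q) : ∃ C : ℝ, 0 < C ∧ ∀ t : ℝ,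
    |t| ^ q ≤ C * (Real.exp t + Real.exp (-t)) := by
  obtain ⟨n, hn⟩ := exists_nat_ge q
  refine ⟨1 + n.factorial, by positivity, fun t => ?_⟩
  have h1 : |t| ^ q ≤ 1 + |t| ^ n := by
    rcases le_total |t| 1 with h | h
    · have := Real.rpow_le_one (abs_nonneg t) h hq.le
      have : 0 ≤ |t| ^ n := by positivity
      linarith
    · have := Real.rpow_le_rpow_of_exponent_le h hn
      rw [Real.rpow_natCast] at this
      linarith
  have h2 := Real.pow_div_factorial_le_exp |t| (abs_nonneg t) n
  rw [div_le_iff₀ (by positivity)] at h2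
  have h3 : Real.exp |t| ≤ Real.exp t + Real.exp (-t) := by
    rcases abs_cases t with h | h <;> rw [h.1] <;> linarith [Real.exp_pos t, Real.exp_pos (-t)]
  have h4 : 1 ≤ Real.exp |t| := Real.one_le_exp (abs_nonneg t)
  have h5 : (0:ℝ) < n.factorial := by positivity
  nlinarith

lemma khintchine (q : ℝ) (hq : 0 < q) : ∃ C : ℝ, 0 < C ∧ ∀ (N : ℕ) (a : Fin N → ℝ),
    ∑ e : Fin N → Bool, |∑ k, sgn (e k) * a k| ^ q ≤ C * 2 ^ N * (∑ k, a k ^ 2) ^ (q / 2) := by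
  obtain ⟨C, hC, h⟩ := abs_rpow_le_exp q hq
  refine ⟨C * 2 * Real.exp (1/2), by positivity, fun N a => ?_⟩
  set s := ∑ k, a k ^ 2 with hs
  have hs0 : 0 ≤ s := Finset.sum_nonneg (fun i _ => sq_nonneg _)
  rcases hs0.eq_or_lt with h0 | h0
  · have : ∀ k, a k = 0 := by
      intro k
      have := (Finset.sum_eq_zero_iff_of_nonneg (fun i _ => sq_nonneg (a i))).1 h0.symm k (Finset.mem_univ _)
      exact pow_eq_zero_iff (two_ne_zero) |>.1 this
    simp only [this, mul_zero, Finset.sum_const_zero, abs_zero, Real.zero_rpow hq.ne']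
    positivity
  · have hr : 0 < √s := Real.sqrt_pos.2 h0
    have key : ∀ e : Fin N → Bool, |∑ k, sgn (e k) * a k| ^ q
        ≤ s ^ (q/2) * (C * (Real.exp (∑ k, sgn (e k) * (a k / √s)) + Real.exp (∑ k, sgn (e k) * (- a k / √s)))) := by
      intro e
      have e1 : ∑ k, sgn (e k) * a k = √s * (∑ k, sgn (e k) * (a k / √s)) := by
        rw [Finset.mul_sum]; refine Finset.sum_congr rfl fun k _ => ?_
        field_simp
      have e2 : ∑ k, sgn (e k) * (- a k / √s) = - (∑ k, sgn (e k) * (a k / √s)) := by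
        rw [← Finset.sum_neg_distrib]; refine Finset.sum_congr rfl fun k _ => ?_
        ring
      rw [e1, e2, abs_mul, abs_of_pos hr, Real.mul_rpow hr.le (abs_nonneg _)]
      have e3 : √s ^ q = s ^ (q/2) := by
        rw [Real.sqrt_eq_rpow, ← Real.rpow_mul hs0]; congr 1; ring
      rw [e3]
      exact mul_le_mul_of_nonneg_left (h _) (by positivity)
    refine (Finset.sum_le_sum fun e _ => key e).trans ?_
    rw [← Finset.mul_sum, ← Finset.mul_sum, Finset.sum_add_distrib]
    have b1 := sum_exp_sgn N (fun k => a k / √s)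
    have b2 := sum_exp_sgn N (fun k => - a k / √s)
    have e4 : ∑ k, (a k / √s)^2 = 1 := by
      simp_rw [div_pow, Real.sq_sqrt hs0]
      rw [← Finset.sum_div, ← hs]; exact div_self h0.ne'
    have e5 : ∑ k, (- a k / √s)^2 = 1 := by
      rw [← e4]; refine Finset.sum_congr rfl fun k _ => by ring
    rw [e4] at b1; rw [e5] at b2
    have : 0 ≤ s ^ (q/2) := by positivity
    calc _ ≤ s ^ (q/2) * (C * (2 ^ N * Real.exp (1/2) + 2 ^ N * Real.exp (1/2))) := by gcongr
      _ = _ := by ring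

lemma sq_sum_rpow_le (q : ℝ) (hq : 0 < q) (N : ℕ) (a : Fin N → ℝ) :
    (∑ k, a k ^ 2) ^ (q / 2) ≤ (N:ℝ) ^ (max (q/2) 1 - 1) * ∑ k, |a k| ^ q := by
  have e : ∀ k, |a k| ^ q = (a k ^ 2) ^ (q/2) := by
    intro k
    rw [← sq_abs, ← Real.rpow_natCast, ← Real.rpow_mul (abs_nonneg _)]; congr 1; push_cast; ring
  simp_rw [e]
  rcases le_total (q/2) 1 with h | h
  · rw [max_eq_right h]; simp only [sub_self, Real.rpow_zero, one_mul]
    have : ∀ t : Finset (Fin N), (∑ k ∈ t, a k ^ 2) ^ (q / 2) ≤ ∑ k ∈ t, (a k ^ 2) ^ (q/2) := by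
      intro t
      induction t using Finset.induction_on with
      | empty => simp [Real.zero_rpow (by positivity : q / 2 ≠ 0)]
      | insert i t hi ih =>
        rw [Finset.sum_insert hi, Finset.sum_insert hi]
        refine (Real.rpow_add_le_add_rpow (sq_nonneg _) (Finset.sum_nonneg fun _ _ => sq_nonneg _) (by positivity) h).trans ?_
        gcongr
    exact this _
  · rw [max_eq_left h]
    have := Real.rpow_sum_le_const_mul_sum_rpow (Finset.univ) (fun k => a k ^ 2) h
    simpa [abs_of_nonneg, sq_nonneg] using this

lemma type_ineq (q : ℝ) (hq : 0 < q) : ∃ C : ℝ≥0∞, C ≠ ∞ ∧ ∀ {α : Type} [MeasurableSpace α] (μ : Measure α)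
    (N : ℕ) (x : Fin N → α → ℝ) (_ : ∀ k, AEStronglyMeasurable (x k) μ) (A : ℝ≥0∞)
    (_ : ∀ k, ∫⁻ t, ‖x k t‖ₑ ^ q ∂μ ≤ A),
    ∃ e : Fin N → Bool, ∫⁻ t, ‖∑ k, sgn (e k) * x k t‖ₑ ^ q ∂μ ≤ C * (N:ℝ≥0∞) ^ (max (q/2) 1) * A := by
  obtain ⟨C, hC, h⟩ := khintchine q hq
  refine ⟨ENNReal.ofReal C, by simp, fun μ N x hx A hA => ?_⟩
  by_contra! hcon
  have en : ∀ r : ℝ, ‖r‖ₑ ^ q = ENNReal.ofReal (|r| ^ q) := by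
    intro r
    rw [← ofReal_norm, ENNReal.ofReal_rpow_of_nonneg (norm_nonneg _) hq.le, Real.norm_eq_abs]
  have hpt : ∀ t, ∑ e : Fin N → Bool, ‖∑ k, sgn (e k) * x k t‖ₑ ^ q
     ≤ ENNReal.ofReal (C * 2^N * (N:ℝ) ^ (max (q/2) 1 - 1)) * ∑ k, ‖x k t‖ₑ ^ q := by
    intro t
    simp_rw [en]
    rw [← ENNReal.ofReal_sum_of_nonneg (fun _ _ => by positivity), ← ENNReal.ofReal_sum_of_nonneg (fun _ _ => by positivity),
      ← ENNReal.ofReal_mul (by positivity)]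
    apply ENNReal.ofReal_le_ofReal
    refine (h N _).trans ?_
    rw [mul_assoc (C * 2^N)]
    exact mul_le_mul_of_nonneg_left (sq_sum_rpow_le q hq N _) (by positivity)
  have hm : ∀ e : Fin N → Bool, AEMeasurable (fun t => ‖∑ k, sgn (e k) * x k t‖ₑ ^ q) μ := by
    intro e
    have : AEStronglyMeasurable (fun t => ∑ k, sgn (e k) * x k t) μ := by
      refine Finset.aestronglyMeasurable_fun_sum _ fun k _ => (hx k).const_mul _
    exact this.enorm.pow_const _
  have h1 : ∑ e : Fin N → Bool, ∫⁻ t, ‖∑ k, sgn (e k) * x k t‖ₑ ^ q ∂μ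
      ≤ ENNReal.ofReal (C * 2^N * (N:ℝ) ^ (max (q/2) 1 - 1)) * (N * A) := by
    rw [← lintegral_finsetSum' _ (fun e _ => hm e)]
    refine (lintegral_mono hpt).trans ?_
    rw [lintegral_const_mul' _ _ (by simp), lintegral_finsetSum' _ (fun k _ => (hx k).enorm.pow_const _)]
    gcongr
    refine (Finset.sum_le_sum fun k _ => hA k).trans ?_
    simp
  have h2 : ENNReal.ofReal (C * 2^N * (N:ℝ) ^ (max (q/2) 1 - 1)) * (N * A)
     = ∑ e : Fin N → Bool, ENNReal.ofReal C * (N:ℝ≥0∞) ^ (max (q/2) 1) * A := by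
    rcases Nat.eq_zero_or_pos N with rfl | hN
    · simp
    have hN' : (0:ℝ) < N := by exact_mod_cast hN
    have hN'' : (N:ℝ≥0∞) ≠ 0 := by simpa using hN.ne'
    rw [Finset.sum_const, Finset.card_univ, ENNReal.ofReal_mul (by positivity), ENNReal.ofReal_mul hC.le,
      ← ENNReal.ofReal_rpow_of_pos hN', ENNReal.ofReal_natCast, ENNReal.rpow_sub _ _ hN'' (by simp)]
    simp only [ENNReal.rpow_one, Fintype.card_fun, Fintype.card_bool, Fintype.card_fin, nsmul_eq_mul]
    rw [ENNReal.ofReal_pow (by norm_num)]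
    push_cast
    rw [show ENNReal.ofReal 2 = 2 by simp]
    calc _ = ENNReal.ofReal C * 2 ^ N * (N ^ max (q / 2) 1 / N * N) * A := by ring
      _ = _ := by rw [ENNReal.div_mul_cancel hN'' (by simp)]; ring
  rw [h2] at h1
  exact absurd h1 (not_le.2 (ENNReal.sum_lt_sum_of_nonempty Finset.univ_nonempty fun e _ => hcon e))


lemma add_rpow_le_eps (p : ℝ) (hp : 0 < p) (e : ℝ≥0∞) (he : e ≠ 0) (he' : e ≠ ∞) (x y : ℝ≥0∞) :
    (x + y) ^ p ≤ (1 + e) ^ p * x ^ p + (1 + e⁻¹) ^ p * y ^ p := by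
  rcases le_total y (e * x) with h | h
  · refine le_add_right ?_
    rw [← ENNReal.mul_rpow_of_nonneg _ _ hp.le]
    gcongr
    rw [add_mul, one_mul]; gcongr
  · refine le_add_left ?_
    rw [← ENNReal.mul_rpow_of_nonneg _ _ hp.le]
    gcongr
    rw [add_mul, one_mul, add_comm]
    gcongr
    calc x = e⁻¹ * (e * x) := by rw [← mul_assoc, ENNReal.inv_mul_cancel he he', one_mul]
      _ ≤ _ := by gcongr

lemma exists_eps (p : ℝ) (hp : 0 < p) (j c : ℝ≥0∞) (hj : j ≠ ∞) (hc : c ≠ 0) (hc' : c ≠ ∞) :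
    ∃ e : ℝ≥0∞, e ≠ 0 ∧ e ≠ ∞ ∧ (1 + e) ^ p * (j + c / 2) ≤ j + 3 * c / 4 := by
  lift j to NNReal using hj
  lift c to NNReal using hc'
  have hc0 : 0 < (c:ℝ) := by
    have : c ≠ 0 := by simpa using hc
    exact_mod_cast pos_iff_ne_zero.2 this
  have hj0 : 0 ≤ (j:ℝ) := j.2
  set A : ℝ := (j + 3 * c / 4) / (j + c/2) with hA
  have hA1 : 1 < A := by rw [hA, one_lt_div (by positivity)]; linarith
  have h1 : 1 < A ^ (1/p) := Real.one_lt_rpow hA1 (by positivity)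
  refine ⟨ENNReal.ofReal (A ^ (1/p) - 1), by simpa using h1, by simp, ?_⟩
  have e1 : 1 + ENNReal.ofReal (A ^ (1/p) - 1) = ENNReal.ofReal (A ^ (1/p)) := by
    rw [← ENNReal.ofReal_one, ← ENNReal.ofReal_add (by norm_num) (by linarith)]; congr 1; ring
  rw [e1, ENNReal.ofReal_rpow_of_pos (by positivity), ← Real.rpow_mul (by positivity)]
  rw [one_div, inv_mul_cancel₀ hp.ne', Real.rpow_one]
  have e2 : ((j:ℝ≥0∞) + c / 2) = ENNReal.ofReal (j + c/2) := by
    rw [ENNReal.ofReal_add (by positivity) (by positivity), ENNReal.ofReal_div_of_pos (by norm_num)]; simp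
  have e3 : ((j:ℝ≥0∞) + 3 * c / 4) = ENNReal.ofReal (j + 3 * c/4) := by
    rw [ENNReal.ofReal_add (by positivity) (by positivity), ENNReal.ofReal_div_of_pos (by norm_num),
      ENNReal.ofReal_mul (by norm_num)]; simp
  rw [e2, e3, ← ENNReal.ofReal_mul (by positivity)]
  apply ENNReal.ofReal_le_ofReal
  rw [hA]; field_simp; rfl

lemma setLIntegral_holder {α : Type} [MeasurableSpace α] (μ : Measure α) (p q : ℝ) (hp : 0 < p) (hpq : p < q)
    (E : Set α) (g : α → ℝ) (hg : AEStronglyMeasurable g μ) : ∫⁻ t in E, ‖g t‖ₑ ^ p ∂μ ≤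
      (∫⁻ t, ‖g t‖ₑ ^ q ∂μ) ^ (p/q) * μ E ^ (1 - p/q) := by
  have hq : 0 < q := hp.trans hpq
  have := ENNReal.lintegral_mul_le_Lp_mul_Lq (μ.restrict E) (p := q/p) (q := (q/p).conjExponent) 
    (Real.HolderConjugate.conjExponent (by rw [one_lt_div hp]; exact hpq))
    (f := fun t => ‖g t‖ₑ ^ p) (g := fun _ => 1) (hg.restrict.enorm.pow_const _) aemeasurable_const
  simp only [Pi.mul_apply, mul_one, ← ENNReal.rpow_mul, ENNReal.one_rpow, lintegral_one, Measure.restrict_apply_univ] at this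
  rw [show p * (q/p) = q by field_simp] at this
  have e : 1 / (q/p).conjExponent = 1 - p/q := by
    rw [Real.conjExponent]
    have : q - p ≠ 0 := by linarith
    field_simp
  rw [e, show 1/(q/p) = p/q by field_simp] at this
  refine this.trans ?_
  gcongr
  exact Measure.restrict_le_self

lemma setLIntegral_small {α : Type} [MeasurableSpace α] (μ : Measure α) (p q : ℝ) (hp : 0 < p) (hpq : p < q)
    (E : Set α) (hE : μ E ≠ ∞) (s : ℝ≥0∞) (hs : s ≠ 0) : ∃ δ : ℝ≥0∞, δ ≠ 0 ∧ ∀ g : α → ℝ,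
      AEStronglyMeasurable g μ → ∫⁻ t, ‖g t‖ₑ ^ q ∂μ ≤ δ → ∫⁻ t in E, ‖g t‖ₑ ^ p ∂μ ≤ s := by
  have hq : 0 < q := hp.trans hpq
  have key := setLIntegral_holder μ p q hp hpq E
  have hpq1 : p/q < 1 := by rw [div_lt_one hq]; exact hpq
  have hM : μ E ^ (1 - p/q) ≠ ∞ := ENNReal.rpow_ne_top_of_nonneg (by linarith) hE
  refine ⟨(s / (1 + μ E ^ (1 - p/q))) ^ (q/p), ?_, fun g hg h => (key g hg).trans ?_⟩
  · have : s / (1 + μ E ^ (1 - p/q)) ≠ 0 := ENNReal.div_ne_zero.2 ⟨hs, by simp [hM]⟩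
    intro h
    rw [ENNReal.rpow_eq_zero_iff] at h
    rcases h with h | h
    · exact this h.1
    · have := div_pos hq hp; linarith
  · calc _ ≤ ((s / (1 + μ E ^ (1 - p/q))) ^ (q/p)) ^ (p/q) * (1 + μ E ^ (1 - p/q)) := by
          gcongr
          exact le_add_self
      _ ≤ _ := by
          rw [← ENNReal.rpow_mul, show q/p * (p/q) = 1 by field_simp, ENNReal.rpow_one]
          exact (ENNReal.div_mul_cancel (by simp) (by simp [hM])).le

lemma almost_disjoint {α : Type} [MeasurableSpace α] (μ : Measure α) (p q : ℝ) (hp : 0 < p) (hpq : p < q)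
    (f : α → ℝ) (hf : AEStronglyMeasurable f μ) (hfi : ∫⁻ t, ‖f t‖ₑ ^ p ∂μ ≠ ∞)
    (c : ℝ≥0∞) (hc : c ≠ 0) (hc' : c ≠ ∞) : ∃ δ : ℝ≥0∞, δ ≠ 0 ∧ ∀ g : α → ℝ,
      AEStronglyMeasurable g μ → ∫⁻ t, ‖g t‖ₑ ^ q ∂μ ≤ δ → c ≤ ∫⁻ t, ‖g t‖ₑ ^ p ∂μ →
      ∫⁻ t, ‖f t‖ₑ ^ p ∂μ + c / 2 ≤ ∫⁻ t, ‖f t + g t‖ₑ ^ p ∂μ := by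
  obtain ⟨e, he, he', hee⟩ := exists_eps p hp _ c hfi hc hc'
  set A := (1 + e) ^ p
  set B := (1 + e⁻¹) ^ p
  have hB : B ≠ ∞ := ENNReal.rpow_ne_top_of_nonneg hp.le (by simp [he])
  set s := c / 16 / (1 + B)
  have hs : s ≠ 0 := ENNReal.div_ne_zero.2 ⟨ENNReal.div_ne_zero.2 ⟨hc, by simp⟩, by simp [hB]⟩
  obtain ⟨E, hEm, hE, hEs⟩ := exists_setLIntegral_compl_lt hfi hs
  obtain ⟨δ, hδ, h⟩ := setLIntegral_small μ p q hp hpq E hE.ne s hs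
  refine ⟨δ, hδ, fun g hg hgq hgp => ?_⟩
  have hgs := h g hg hgq
  by_contra! hcon
  have hfm : AEMeasurable (fun t => ‖f t‖ₑ ^ p) μ := hf.enorm.pow_const _
  have hgm : AEMeasurable (fun t => ‖g t‖ₑ ^ p) μ := hg.enorm.pow_const _
  have hfgm : AEMeasurable (fun t => ‖f t + g t‖ₑ ^ p) μ := (hf.add hg).enorm.pow_const _
  have h1 : ∀ t, ‖f t‖ₑ ^ p ≤ A * ‖f t + g t‖ₑ ^ p + B * ‖g t‖ₑ ^ p := by
    intro t
    refine le_trans ?_ (add_rpow_le_eps p hp e he he' _ _)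
    gcongr
    calc ‖f t‖ₑ = ‖(f t + g t) - g t‖ₑ := by congr 1; ring
      _ ≤ _ := enorm_sub_le
  have h2 : ∀ t, ‖g t‖ₑ ^ p ≤ A * ‖f t + g t‖ₑ ^ p + B * ‖f t‖ₑ ^ p := by
    intro t
    refine le_trans ?_ (add_rpow_le_eps p hp e he he' _ _)
    gcongr
    calc ‖g t‖ₑ = ‖(f t + g t) - f t‖ₑ := by congr 1; ring
      _ ≤ _ := enorm_sub_le
  have hA : A ≠ ∞ := ENNReal.rpow_ne_top_of_nonneg hp.le (by simp [he'])
  have i1 : ∫⁻ t in E, ‖f t‖ₑ ^ p ∂μ ≤ A * ∫⁻ t in E, ‖f t + g t‖ₑ ^ p ∂μ + B * s := by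
    refine (lintegral_mono h1).trans ?_
    rw [lintegral_add_left' (hfgm.restrict.const_mul _), lintegral_const_mul' _ _ hA, lintegral_const_mul' _ _ hB]
    gcongr
  have i2 : ∫⁻ t in Eᶜ, ‖g t‖ₑ ^ p ∂μ ≤ A * ∫⁻ t in Eᶜ, ‖f t + g t‖ₑ ^ p ∂μ + B * s := by
    refine (lintegral_mono h2).trans ?_
    rw [lintegral_add_left' (hfgm.restrict.const_mul _), lintegral_const_mul' _ _ hA, lintegral_const_mul' _ _ hB]
    gcongr
  have j1 := lintegral_add_compl (μ := μ) (fun t => ‖f t‖ₑ ^ p) hEm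
  have j2 := lintegral_add_compl (μ := μ) (fun t => ‖g t‖ₑ ^ p) hEm
  have j3 := lintegral_add_compl (μ := μ) (fun t => ‖f t + g t‖ₑ ^ p) hEm
  have hBs : (1 + B) * s ≤ c / 16 := by rw [mul_comm]; exact (ENNReal.div_mul_cancel (by simp) (by simp [hB])).le
  have tot : ∫⁻ t, ‖f t‖ₑ ^ p ∂μ + c ≤ (∫⁻ t, ‖f t‖ₑ ^ p ∂μ + 3 * c / 4) + 2 * (c / 16) := by
    calc _ ≤ ∫⁻ t, ‖f t‖ₑ ^ p ∂μ + ∫⁻ t, ‖g t‖ₑ ^ p ∂μ := by gcongr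
      _ = (∫⁻ t in E, ‖f t‖ₑ ^ p ∂μ + ∫⁻ t in Eᶜ, ‖f t‖ₑ ^ p ∂μ) + (∫⁻ t in E, ‖g t‖ₑ ^ p ∂μ + ∫⁻ t in Eᶜ, ‖g t‖ₑ ^ p ∂μ) := by rw [j1, j2]
      _ ≤ ((A * ∫⁻ t in E, ‖f t + g t‖ₑ ^ p ∂μ + B * s) + s) + (s + (A * ∫⁻ t in Eᶜ, ‖f t + g t‖ₑ ^ p ∂μ + B * s)) := by
          gcongr
      _ = A * (∫⁻ t in E, ‖f t + g t‖ₑ ^ p ∂μ + ∫⁻ t in Eᶜ, ‖f t + g t‖ₑ ^ p ∂μ) + 2 * ((1 + B) * s) := by ring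
      _ ≤ _ := by
          rw [j3]
          gcongr
          refine le_trans ?_ hee
          gcongr
  lift c to NNReal using hc'
  generalize ∫⁻ t, ‖f t‖ₑ ^ p ∂μ = j at *
  lift j to NNReal using hfi
  have e1 : ((j:ℝ≥0∞) + 3 * c / 4) + 2 * (c / 16) = ((j + 3 * c / 4 + 2 * (c/16) : NNReal) : ℝ≥0∞) := by
    push_cast
    rw [show ((c / 16 : NNReal) : ℝ≥0∞) = c / 16 from by rw [ENNReal.coe_div (by norm_num)]; rfl]
  rw [e1] at tot
  have tot2 : j + c ≤ j + 3 * c / 4 + 2 * (c/16) := by exact_mod_cast tot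
  have tot3 : (j:ℝ) + c ≤ j + 3 * c / 4 + 2 * (c/16) := by exact_mod_cast tot2
  have hc0 : 0 < (c:ℝ) := by
    have : c ≠ 0 := by simpa using hc
    exact_mod_cast pos_iff_ne_zero.2 this
  linarith


/-- The power integral `∫ |f|^p`. -/
def JJ (p : ℝ) (f : ℝ →ₘ[m0] ℝ) : ℝ≥0∞ := ∫⁻ t, ‖f t‖ₑ ^ p ∂m0

/-- Square-integrable functions vanishing outside `(0, 1]`. -/
def V0 : Submodule ℝ (ℝ →ₘ[m0] ℝ) where
  carrier := {f | MemLp f 2 m0 ∧ ∀ᵐ x ∂m0, 1 < x → f x = 0}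
  zero_mem' := by
    refine ⟨(MemLp.zero (p := 2) (μ := m0) (ε := ℝ)).ae_eq AEEqFun.coeFn_zero.symm, ?_⟩
    filter_upwards [AEEqFun.coeFn_zero (α := ℝ) (β := ℝ) (μ := m0)] with x hx _
    rw [hx]; rfl
  add_mem' := by
    rintro f g ⟨hf, hf'⟩ ⟨hg, hg'⟩
    refine ⟨(hf.add hg).ae_eq (AEEqFun.coeFn_add f g).symm, ?_⟩
    filter_upwards [AEEqFun.coeFn_add f g, hf', hg'] with x hx h1 h2 h
    rw [hx]; simp [h1 h, h2 h]
  smul_mem' := by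
    rintro c f ⟨hf, hf'⟩
    refine ⟨(hf.const_smul c).ae_eq (AEEqFun.coeFn_smul c f).symm, ?_⟩
    filter_upwards [AEEqFun.coeFn_smul c f, hf'] with x hx h1 h
    rw [hx]; simp [h1 h]

lemma m0_Ioc (a b : ℝ) (ha : 0 ≤ a) : m0 (Set.Ioc a b) = ENNReal.ofReal (b - a) := by
  rw [m0, Measure.restrict_apply measurableSet_Ioc, Set.inter_eq_left.2, Real.volume_Ioc]
  intro x hx; exact lt_of_le_of_lt ha hx.1

lemma m0_Iic_one : m0 (Set.Iic 1) = 1 := by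
  rw [m0, Measure.restrict_apply measurableSet_Iic, Set.Iic_inter_Ioi, Real.volume_Ioc]; simp

lemma ae_pos : ∀ᵐ x ∂m0, 0 < x := ae_restrict_mem measurableSet_Ioi

lemma JJ_congr (p : ℝ) (f : ℝ →ₘ[m0] ℝ) (g : ℝ → ℝ) (h : f =ᵐ[m0] g) : JJ p f = ∫⁻ t, ‖g t‖ₑ ^ p ∂m0 := by
  refine lintegral_congr_ae ?_
  filter_upwards [h] with x hx; rw [hx]

lemma JJ_V0 (p : ℝ) (hp : 0 < p) (f : ℝ →ₘ[m0] ℝ) (hf : ∀ᵐ x ∂m0, 1 < x → f x = 0) :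
    JJ p f = ∫⁻ t in Set.Iic 1, ‖f t‖ₑ ^ p ∂m0 := by
  rw [JJ, ← lintegral_indicator measurableSet_Iic]
  refine lintegral_congr_ae ?_
  filter_upwards [hf] with x hx
  by_cases h : x ≤ 1
  · rw [Set.indicator_of_mem (by exact h)]
  · rw [Set.indicator_of_notMem (by exact h), hx (not_le.1 h)]; simp [hp]

lemma JJ_holder (p q : ℝ) (hp : 0 < p) (hpq : p < q) (f : ℝ →ₘ[m0] ℝ) (hf : ∀ᵐ x ∂m0, 1 < x → f x = 0) :
    JJ p f ≤ (JJ q f) ^ (p/q) := by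
  rw [JJ_V0 p hp f hf]
  refine (setLIntegral_holder m0 p q hp hpq (Set.Iic 1) f f.aestronglyMeasurable).trans ?_
  rw [m0_Iic_one]; simp [JJ]

def blkF (N : ℕ) (k : Fin N) : ℝ → ℝ := (Set.Ioc ((k:ℝ)/N) (((k:ℝ)+1)/N)).indicator (fun _ => 1)

lemma blkF_meas (N : ℕ) (k : Fin N) : Measurable (blkF N k) := measurable_const.indicator measurableSet_Ioc

lemma blk_sum (N : ℕ) (hN : 0 < N) (e : Fin N → ℝ) (he : ∀ k, |e k| = 1) (x : ℝ) (hx : 0 < x) :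
    |∑ k, e k * blkF N k x| = (Set.Iic (1:ℝ)).indicator (fun _ => 1) x := by
  by_cases h1 : x ≤ 1
  · rw [Set.indicator_of_mem (by exact h1)]
    have hN' : (0:ℝ) < N := by exact_mod_cast hN
    have hc0 : 0 < ⌈x * N⌉₊ := Nat.ceil_pos.2 (by positivity)
    have hcN : ⌈x * N⌉₊ ≤ N := Nat.ceil_le.2 (by nlinarith)
    obtain ⟨j, hj⟩ : ∃ j, ⌈x * N⌉₊ = j + 1 := ⟨⌈x * N⌉₊ - 1, by omega⟩
    have hjN : j < N := by omega
    have hj2 := (Nat.ceil_eq_iff (by omega)).1 hj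
    rw [Finset.sum_eq_single ⟨j, hjN⟩]
    · rw [blkF, Set.indicator_of_mem, mul_one, he]
      constructor
      · rw [div_lt_iff₀ hN']; simpa using hj2.1
      · rw [le_div_iff₀ hN']; simpa using hj2.2
    · intro k _ hk
      rw [blkF, Set.indicator_of_notMem, mul_zero]
      rintro ⟨a1, a2⟩
      rw [div_lt_iff₀ hN'] at a1
      rw [le_div_iff₀ hN'] at a2
      apply hk
      have : ⌈x * N⌉₊ = k.1 + 1 := (Nat.ceil_eq_iff (by omega)).2 ⟨by simpa using a1, by simpa using a2⟩
      ext; simp; omega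
    · simp
  · rw [Set.indicator_of_notMem (by exact h1)]
    rw [Finset.sum_eq_zero, abs_zero]
    intro k _
    rw [blkF, Set.indicator_of_notMem, mul_zero]
    rintro ⟨a1, a2⟩
    have hN' : (0:ℝ) < N := by exact_mod_cast k.pos
    have h3 : ((k:ℝ)+1)/N ≤ 1 := by
      rw [div_le_one hN']
      exact_mod_cast k.2
    linarith

lemma lint_blkF (N : ℕ) (hN : 0 < N) (k : Fin N) (p : ℝ) (hp : 0 < p) :
    ∫⁻ t, ‖blkF N k t‖ₑ ^ p ∂m0 = (N:ℝ≥0∞)⁻¹ := by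
  have hN' : (0:ℝ) < N := by exact_mod_cast hN
  have : ∀ t, ‖blkF N k t‖ₑ ^ p = (Set.Ioc ((k:ℝ)/N) (((k:ℝ)+1)/N)).indicator (fun _ => 1) t := by
    intro t
    by_cases h : t ∈ Set.Ioc ((k:ℝ)/N) (((k:ℝ)+1)/N)
    · rw [blkF, Set.indicator_of_mem h, Set.indicator_of_mem h]; simp
    · rw [blkF, Set.indicator_of_notMem h, Set.indicator_of_notMem h]; simp [hp]
  simp_rw [this]
  rw [lintegral_indicator measurableSet_Ioc]
  simp only [lintegral_const, Measure.restrict_apply_univ, one_mul]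
  rw [m0_Ioc _ _ (by positivity)]
  rw [show ((k:ℝ)+1)/N - (k:ℝ)/N = (N:ℝ)⁻¹ by field_simp; ring, ENNReal.ofReal_inv_of_pos hN']
  simp

lemma blk_mem (N : ℕ) (hN : 0 < N) (k : Fin N) :
    (AEEqFun.mk (blkF N k) (blkF_meas N k).aestronglyMeasurable : ℝ →ₘ[m0] ℝ) ∈ V0 := by
  have hN' : (0:ℝ) < N := by exact_mod_cast hN
  constructor
  · refine MemLp.ae_eq (AEEqFun.coeFn_mk _ _).symm ?_
    refine memLp_indicator_const 2 measurableSet_Ioc 1 (Or.inr ?_)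
    rw [m0_Ioc _ _ (by positivity)]; simp
  · filter_upwards [AEEqFun.coeFn_mk (blkF N k) (blkF_meas N k).aestronglyMeasurable (μ := m0)] with x hx h
    rw [hx, blkF, Set.indicator_of_notMem]
    intro h2
    have h3 : ((k:ℝ)+1)/N ≤ 1 := by
      rw [div_le_one hN']
      exact_mod_cast k.2
    linarith [h2.2]

def blk (N : ℕ) (hN : 0 < N) (k : Fin N) : V0 := ⟨_, blk_mem N hN k⟩

lemma blk_coe (N : ℕ) (hN : 0 < N) (k : Fin N) : ((blk N hN k : ℝ →ₘ[m0] ℝ) : ℝ → ℝ) =ᵐ[m0] blkF N k :=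
  AEEqFun.coeFn_mk _ _

lemma coeFn_lincomb {ι : Type} (s : Finset ι) (a : ι → ℝ) (F : ι → ℝ →ₘ[m0] ℝ) :
    ((∑ k ∈ s, a k • F k : ℝ →ₘ[m0] ℝ) : ℝ → ℝ) =ᵐ[m0] fun t => ∑ k ∈ s, a k * F k t := by
  classical
  induction s using Finset.induction_on with
  | empty => simp only [Finset.sum_empty]; exact AEEqFun.coeFn_zero
  | insert i s hi ih =>
    rw [Finset.sum_insert hi]
    filter_upwards [ih, AEEqFun.coeFn_add (a i • F i) (∑ k ∈ s, a k • F k), AEEqFun.coeFn_smul (a i) (F i)] with x h1 h2 h3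
    rw [h2, Finset.sum_insert hi, Pi.add_apply, h1, h3]; simp

lemma exists_small (p q : ℝ) (hp : 1 < p) (hpq : p < q) (hp2 : p < 2) (S : V0 →ₗ[ℝ] (ℝ →ₘ[m0] ℝ))
    (K : ℝ≥0∞) (hK : K ≠ ∞) (h2 : ∀ f : V0, JJ q (S f) ≤ K * (JJ p f) ^ (q/p)) (δ : ℝ≥0∞) (hδ : δ ≠ 0) :
    ∃ h : V0, (∀ r : ℝ, 0 < r → JJ r h = 1) ∧ JJ q (S h) ≤ δ := by
  have hp0 : 0 < p := by linarith
  have hq0 : 0 < q := by linarith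
  obtain ⟨C, hC, hty⟩ := type_ineq q hq0
  have hβ : max (q/2) 1 < q/p := by
    rw [max_lt_iff]; constructor
    · gcongr
    · rw [one_lt_div hp0]; exact hpq
  set mx := max (q/2) 1
  have hlim : Filter.Tendsto (fun N : ℕ => (C * K) * ((N:ℝ≥0∞)⁻¹) ^ (q/p - mx)) Filter.atTop (nhds 0) := by
    have h1 := (ENNReal.continuous_rpow_const (y := q/p - mx)).continuousAt.tendsto.comp ENNReal.tendsto_inv_nat_nhds_zero
    rw [ENNReal.zero_rpow_of_pos (by linarith)] at h1
    have := ENNReal.Tendsto.const_mul (a := C * K) h1 (Or.inr (ENNReal.mul_ne_top hC hK))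
    simpa using this
  obtain ⟨N, hN1, hN⟩ := ((hlim.eventually_lt_const (pos_iff_ne_zero.2 hδ)).and (Filter.eventually_gt_atTop 0)).exists
  obtain ⟨e, he⟩ := hty m0 N (fun k => (S (blk N hN k) : ℝ → ℝ)) (fun k => AEEqFun.aestronglyMeasurable _)
    (K * ((N:ℝ≥0∞)⁻¹) ^ (q/p)) (fun k => by
      refine (h2 _).trans (le_of_eq ?_)
      rw [JJ_congr p _ _ (blk_coe N hN k), lint_blkF N hN k p hp0])
  refine ⟨∑ k, sgn (e k) • blk N hN k, fun r hr => ?_, ?_⟩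
  · have hcoe : (((∑ k, sgn (e k) • blk N hN k : V0) : ℝ →ₘ[m0] ℝ) : ℝ → ℝ) =ᵐ[m0]
        fun t => ∑ k, sgn (e k) * blkF N k t := by
      have := coeFn_lincomb Finset.univ (fun k => sgn (e k)) (fun k => (blk N hN k : ℝ →ₘ[m0] ℝ))
      have hall : ∀ᵐ t ∂m0, ∀ k, (blk N hN k : ℝ →ₘ[m0] ℝ) t = blkF N k t := ae_all_iff.2 fun k => blk_coe N hN k
      push_cast
      filter_upwards [this, hall] with t h1 h2
      rw [h1]; simp_rw [h2]
    rw [JJ_congr r _ _ hcoe]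
    have : ∀ᵐ t ∂m0, ‖∑ k, sgn (e k) * blkF N k t‖ₑ ^ r = (Set.Iic (1:ℝ)).indicator (fun _ => 1) t := by
      filter_upwards [ae_pos] with t ht
      rw [← ofReal_norm, Real.norm_eq_abs, blk_sum N hN _ (fun k => sgn_abs _) t ht]
      by_cases h : t ∈ Set.Iic (1:ℝ)
      · rw [Set.indicator_of_mem h, Set.indicator_of_mem h]; simp
      · rw [Set.indicator_of_notMem h, Set.indicator_of_notMem h]; simp [hr]
    rw [lintegral_congr_ae this, lintegral_indicator measurableSet_Iic]
    simp [m0_Iic_one]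
  · rw [map_sum]
    simp_rw [map_smul]
    rw [JJ_congr q _ _ (coeFn_lincomb Finset.univ (fun k => sgn (e k)) (fun k => S (blk N hN k)))]
    refine he.trans (le_trans (le_of_eq ?_) hN1.le)
    have hN'' : (N:ℝ≥0∞) ≠ 0 := by simpa using hN.ne'
    have e1 : (N:ℝ≥0∞) ^ mx * ((N:ℝ≥0∞)⁻¹) ^ (q/p) = ((N:ℝ≥0∞)⁻¹) ^ (q/p - mx) := by
      rw [ENNReal.inv_rpow, ENNReal.inv_rpow, ← ENNReal.rpow_neg, ← ENNReal.rpow_neg,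
        ← ENNReal.rpow_add _ _ hN'' (by simp)]
      congr 1; ring
    rw [← e1]; ring

theorem core (p q : ℝ) (hp : 1 < p) (hpq : p < q) (hp2 : p < 2) (S : V0 →ₗ[ℝ] (ℝ →ₘ[m0] ℝ))
    (K c : ℝ≥0∞) (hK : K ≠ ∞) (hc : c ≠ 0)
    (h1 : ∀ f : V0, JJ p (S f) ≤ K * JJ p f)
    (h2 : ∀ f : V0, JJ q (S f) ≤ K * (JJ p f) ^ (q/p))
    (h3 : ∀ f : V0, JJ p f = 1 → c ≤ JJ p (S f) ∨ c ≤ JJ q (S f)) : False := by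
  wlog hct : c ≠ ∞ generalizing c
  · refine this 1 one_ne_zero (fun f hf => ?_) (by simp)
    rw [not_not] at hct
    subst hct
    rcases h3 f hf with h | h
    · left; exact le_trans le_top h
    · right; exact le_trans le_top h
  have hp0 : 0 < p := by linarith
  have ind : ∀ m : ℕ, ∃ H : V0, JJ 2 H ≤ m ∧ m * (c/2) ≤ JJ p (S H) := by
    intro m
    induction m with
    | zero =>
      refine ⟨0, ?_, by simp⟩
      rw [JJ_congr 2 _ (fun _ => 0) (by exact AEEqFun.coeFn_zero)]
      simp
    | succ m ih =>
      obtain ⟨H, hH2, hHp⟩ := ih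
      have hfin : JJ p (S H) ≠ ∞ := by
        refine ne_top_of_le_ne_top ?_ (h1 H)
        refine ENNReal.mul_ne_top hK (ne_top_of_le_ne_top ?_ (JJ_holder p 2 hp0 hp2 H H.2.2))
        exact ENNReal.rpow_ne_top_of_nonneg (by positivity) (ne_top_of_le_ne_top (by simp) hH2)
      obtain ⟨δ, hδ, had⟩ := almost_disjoint m0 p q hp0 hpq (S H) (AEEqFun.aestronglyMeasurable _) hfin c hc hct
      obtain ⟨h, hr, hq⟩ := exists_small p q hp hpq hp2 S K hK h2 (min δ (c/2)) (by simp [hδ, hc])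
      have hcq : c ≤ JJ p (S h) := by
        rcases h3 h (hr p hp0) with h' | h'
        · exact h'
        · exfalso
          have := h'.trans (hq.trans (min_le_right _ _))
          exact absurd this (not_le.2 (ENNReal.half_lt_self hc hct))
      have hneg : ∀ r, JJ r (S (-h)) = JJ r (S h) := by
        intro r
        rw [map_neg, JJ_congr r _ _ (AEEqFun.coeFn_neg (S h)), JJ]
        simp
      have step : ∀ h' : V0, JJ q (S h') ≤ min δ (c/2) → c ≤ JJ p (S h') →
          ((m+1 : ℕ):ℝ≥0∞) * (c/2) ≤ JJ p (S (H + h')) := by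
        intro h' a1 a2
        have := had (S h') (AEEqFun.aestronglyMeasurable _) (a1.trans (min_le_left _ _)) a2
        rw [map_add, JJ_congr p _ _ (AEEqFun.coeFn_add (S H) (S h'))]
        refine le_trans ?_ this
        push_cast
        rw [add_mul, one_mul]
        gcongr
        exact hHp
      have par : JJ 2 (H + h : V0) + JJ 2 (H + (-h) : V0) ≤ ((m+1:ℕ):ℝ≥0∞) + ((m+1 : ℕ):ℝ≥0∞) := by
        have e : ∀ a : ℝ, ‖a‖ₑ ^ (2:ℝ) = ENNReal.ofReal (a ^ 2) := by
          intro a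
          rw [← ofReal_norm, ENNReal.ofReal_rpow_of_nonneg (norm_nonneg _) (by norm_num)]
          simp
        have hH2' : ∫⁻ t, ‖(H : ℝ →ₘ[m0] ℝ) t‖ₑ ^ (2:ℝ) ∂m0 ≤ m := hH2
        have hh2' : ∫⁻ t, ‖(h : ℝ →ₘ[m0] ℝ) t‖ₑ ^ (2:ℝ) ∂m0 = 1 := hr 2 (by norm_num)
        have m1 : AEStronglyMeasurable (H : ℝ →ₘ[m0] ℝ) m0 := AEEqFun.aestronglyMeasurable _
        have m2 : AEStronglyMeasurable (h : ℝ →ₘ[m0] ℝ) m0 := AEEqFun.aestronglyMeasurable _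
        have c2 : (((H + -h : V0) : ℝ →ₘ[m0] ℝ) : ℝ → ℝ) =ᵐ[m0] fun t => (H : ℝ →ₘ[m0] ℝ) t - (h : ℝ →ₘ[m0] ℝ) t := by
          push_cast
          filter_upwards [AEEqFun.coeFn_add (H : ℝ →ₘ[m0] ℝ) (-(h : ℝ →ₘ[m0] ℝ)), AEEqFun.coeFn_neg (h : ℝ →ₘ[m0] ℝ)] with t a1 a2
          rw [a1, Pi.add_apply, a2, Pi.neg_apply]; ring
        rw [JJ_congr 2 ((H + h : V0) : ℝ →ₘ[m0] ℝ) _ (AEEqFun.coeFn_add (H : ℝ →ₘ[m0] ℝ) (h : ℝ →ₘ[m0] ℝ)), JJ_congr 2 _ _ c2]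
        simp only [Pi.add_apply]
        have mm : AEMeasurable (fun t => ‖(H : ℝ →ₘ[m0] ℝ) t + (h : ℝ →ₘ[m0] ℝ) t‖ₑ ^ (2:ℝ)) m0 :=
          (m1.add m2).enorm.pow_const _
        rw [← lintegral_add_left' mm]
        calc _ = ∫⁻ t, ((‖(H : ℝ →ₘ[m0] ℝ) t‖ₑ ^ (2:ℝ) + ‖(h : ℝ →ₘ[m0] ℝ) t‖ₑ ^ (2:ℝ))
                + (‖(H : ℝ →ₘ[m0] ℝ) t‖ₑ ^ (2:ℝ) + ‖(h : ℝ →ₘ[m0] ℝ) t‖ₑ ^ (2:ℝ))) ∂m0 := by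
              refine lintegral_congr fun t => ?_
              simp only [e]
              rw [← ENNReal.ofReal_add (by positivity) (by positivity), ← ENNReal.ofReal_add (by positivity) (by positivity),
                ← ENNReal.ofReal_add (by positivity) (by positivity)]
              congr 1; ring
          _ = (∫⁻ t, ‖(H : ℝ →ₘ[m0] ℝ) t‖ₑ ^ (2:ℝ) ∂m0 + ∫⁻ t, ‖(h : ℝ →ₘ[m0] ℝ) t‖ₑ ^ (2:ℝ) ∂m0)
              + (∫⁻ t, ‖(H : ℝ →ₘ[m0] ℝ) t‖ₑ ^ (2:ℝ) ∂m0 + ∫⁻ t, ‖(h : ℝ →ₘ[m0] ℝ) t‖ₑ ^ (2:ℝ) ∂m0) := by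
              have mm1 : AEMeasurable (fun t => ‖(H : ℝ →ₘ[m0] ℝ) t‖ₑ ^ (2:ℝ)) m0 := m1.enorm.pow_const _
              have mm3 : AEMeasurable (fun t => ‖(h : ℝ →ₘ[m0] ℝ) t‖ₑ ^ (2:ℝ)) m0 := m2.enorm.pow_const _
              have mm2 : AEMeasurable (fun t => ‖(H : ℝ →ₘ[m0] ℝ) t‖ₑ ^ (2:ℝ) + ‖(h : ℝ →ₘ[m0] ℝ) t‖ₑ ^ (2:ℝ)) m0 :=
                mm1.add mm3
              rw [lintegral_add_left' mm2, lintegral_add_left' mm1]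
          _ ≤ _ := by
              rw [hh2']; push_cast
              gcongr
      rcases le_or_gt (JJ 2 (H + h : V0)) ((m+1 : ℕ):ℝ≥0∞) with hle | hgt
      · exact ⟨H + h, hle, step h hq hcq⟩
      · refine ⟨H + -h, ?_, step (-h) (by rwa [hneg]) (by rwa [hneg])⟩
        by_contra! hgt2
        exact absurd par (not_le.2 (ENNReal.add_lt_add hgt hgt2))
  have fin : ∀ m : ℕ, (m:ℝ≥0∞) * (c/2) ≤ K * (m:ℝ≥0∞) ^ (p/2) := by
    intro m
    obtain ⟨H, hH2, hHp⟩ := ind m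
    refine hHp.trans ((h1 H).trans ?_)
    gcongr
    refine (JJ_holder p 2 hp0 hp2 H H.2.2).trans ?_
    gcongr
  have hc2 : c / 2 ≠ 0 := by simp [hc]
  have hc2' : c / 2 ≠ ∞ := ENNReal.div_ne_top hct (by simp)
  have hγ : 0 < 1 - p/2 := by linarith
  obtain ⟨m, hm⟩ := ENNReal.exists_nat_gt (r := (K / (c/2)) ^ (1 / (1 - p/2)))
    (ENNReal.rpow_ne_top_of_nonneg (by positivity) (ENNReal.div_ne_top hK hc2))
  have hm0 : (m:ℝ≥0∞) ≠ 0 := (lt_of_le_of_lt zero_le hm).ne'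
  have h4 := fin m
  have e1 : (m:ℝ≥0∞) = (m:ℝ≥0∞) ^ (1 - p/2) * (m:ℝ≥0∞) ^ (p/2) := by
    rw [← ENNReal.rpow_add _ _ hm0 (by simp)]; simp
  nth_rewrite 1 [e1] at h4
  rw [mul_right_comm] at h4
  have h5 := (ENNReal.mul_le_mul_iff_left (ENNReal.rpow_pos (pos_iff_ne_zero.2 hm0) (by simp)).ne'
    (ENNReal.rpow_ne_top_of_nonneg (by positivity) (by simp))).1 h4
  rw [← ENNReal.le_div_iff_mul_le (Or.inl hc2) (Or.inl hc2')] at h5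
  have h6 := ENNReal.rpow_le_rpow h5 (z := 1 / (1 - p/2)) (by positivity)
  rw [← ENNReal.rpow_mul, mul_one_div_cancel hγ.ne', ENNReal.rpow_one] at h6
  exact absurd hm (not_lt.2 h6)


lemma clarkson_pt (r : ℝ) (hr : 2 ≤ r) (a b : ℝ) :
    |(a + b) / 2| ^ r + |(a - b) / 2| ^ r ≤ (|a| ^ r + |b| ^ r) / 2 := by
  have e : ∀ c : ℝ, |c| ^ r = (c ^ 2) ^ (r/2) := by
    intro c
    rw [← sq_abs, ← Real.rpow_natCast, ← Real.rpow_mul (abs_nonneg _)]; congr 1; push_cast; ring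
  simp only [e]
  have hs : 1 ≤ r/2 := by linarith
  refine (Real.add_rpow_le_rpow_add (sq_nonneg _) (sq_nonneg _) hs).trans ?_
  have := (convexOn_rpow hs).2 (Set.mem_Ici.2 (sq_nonneg a)) (Set.mem_Ici.2 (sq_nonneg b))
    (by norm_num : (0:ℝ) ≤ 1/2) (by norm_num : (0:ℝ) ≤ 1/2) (by norm_num)
  simp only [smul_eq_mul] at this
  calc (((a + b) / 2) ^ 2 + ((a - b) / 2) ^ 2) ^ (r/2) = (1/2 * a^2 + 1/2 * b^2) ^ (r/2) := by congr 1; ring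
    _ ≤ _ := this
    _ = _ := by ring

lemma norm_rpow_eq {α : Type} [MeasurableSpace α] (μ : Measure α) (r : ℝ) (hr : 1 ≤ r)
    (u : Lp ℝ (ENNReal.ofReal r) μ) : ‖u‖ ^ r = ∫ t, |u t| ^ r ∂μ := by
  have h0 : 0 < r := by linarith
  rw [Lp.norm_def, (Lp.memLp u).eLpNorm_eq_integral_rpow_norm (by simpa using h0) (by simp)]
  rw [ENNReal.toReal_ofReal h0.le]
  have : 0 ≤ ∫ t, ‖u t‖ ^ r ∂μ := integral_nonneg fun t => by positivity
  rw [ENNReal.toReal_ofReal (by positivity), ← Real.rpow_mul this, inv_mul_cancel₀ h0.ne', Real.rpow_one]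
  simp

lemma integrable_rpow {α : Type} [MeasurableSpace α] (μ : Measure α) (r : ℝ) (hr : 1 ≤ r)
    (u : α → ℝ) (hu : MemLp u (ENNReal.ofReal r) μ) : Integrable (fun t => |u t| ^ r) μ := by
  have h0 : 0 < r := by linarith
  have := hu.integrable_norm_rpow (by simpa using h0) (by simp)
  simpa [ENNReal.toReal_ofReal h0.le] using this

lemma clarkson {α : Type} [MeasurableSpace α] (μ : Measure α) (r : ℝ) (hr : 2 ≤ r)
    [Fact (1 ≤ ENNReal.ofReal r)]
    (u v : Lp ℝ (ENNReal.ofReal r) μ) :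
    ‖(1/2 : ℝ) • (u + v)‖ ^ r + ‖(1/2 : ℝ) • (u - v)‖ ^ r ≤ (‖u‖ ^ r + ‖v‖ ^ r) / 2 := by
  have h1 : 1 ≤ r := by linarith
  simp only [norm_rpow_eq μ r h1]
  have i := fun w : Lp ℝ (ENNReal.ofReal r) μ => integrable_rpow μ r h1 w (Lp.memLp w)
  rw [← integral_add (i _) (i _), ← integral_add (i _) (i _), ← integral_div]
  refine integral_mono_ae ((i _).add (i _)) (((i _).add (i _)).div_const _) ?_
  filter_upwards [Lp.coeFn_smul (1/2 : ℝ) (u + v), Lp.coeFn_smul (1/2 : ℝ) (u - v), Lp.coeFn_add u v, Lp.coeFn_sub u v] with t a1 a2 a3 a4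
  simp only [a1, a2, Pi.smul_apply, a3, a4, Pi.add_apply, Pi.sub_apply, smul_eq_mul]
  have := clarkson_pt r hr (u t) (v t)
  rwa [show (u t + v t) / 2 = 1/2 * (u t + v t) by ring, show (u t - v t) / 2 = 1/2 * (u t - v t) by ring] at this

lemma exists_min {α : Type} [MeasurableSpace α] (μ : Measure α) (r : ℝ) (hr : 2 ≤ r)
    [Fact (1 ≤ ENNReal.ofReal r)] (φ : Lp ℝ (ENNReal.ofReal r) μ →L[ℝ] ℝ) :
    ∃ x : Lp ℝ (ENNReal.ofReal r) μ, ∀ y, ‖x‖ ^ r - φ x ≤ ‖y‖ ^ r - φ y := by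
  have h0 : 0 < r := by linarith
  set G : Lp ℝ (ENNReal.ofReal r) μ → ℝ := fun y => ‖y‖ ^ r - φ y with hG
  have hGc : Continuous G := (continuous_norm.rpow_const (fun _ => Or.inr h0.le)).sub φ.continuous
  have hbdd : BddBelow (Set.range G) := by
    refine ⟨-(‖φ‖ * (1 + ‖φ‖)), ?_⟩
    rintro _ ⟨y, rfl⟩
    have h1 : φ y ≤ ‖φ‖ * ‖y‖ := (le_abs_self _).trans (φ.le_opNorm y)
    have hφ := norm_nonneg φ
    have hy := norm_nonneg y
    have hyr : 0 ≤ ‖y‖ ^ r := by positivity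
    simp only [hG]
    rcases le_total ‖y‖ (1 + ‖φ‖) with h | h
    · nlinarith
    · have h2 : ‖y‖ ^ (2:ℝ) ≤ ‖y‖ ^ r := Real.rpow_le_rpow_of_exponent_le (by linarith) hr
      rw [Real.rpow_two] at h2
      nlinarith
  set I := sInf (Set.range G)
  have hI : ∀ y, I ≤ G y := fun y => csInf_le hbdd ⟨y, rfl⟩
  have hex : ∀ n : ℕ, ∃ y, G y < I + 1 / ((n:ℝ) + 1) := by
    intro n
    obtain ⟨_, ⟨y, rfl⟩, hy⟩ := exists_lt_of_csInf_lt (Set.range_nonempty G)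
      (lt_add_of_pos_right I (by positivity : 0 < 1 / ((n:ℝ) + 1)))
    exact ⟨y, hy⟩
  choose u hu using hex
  have key : ∀ n m, ‖(1/2 : ℝ) • (u n - u m)‖ ^ r ≤ (1 / ((n:ℝ) + 1) + 1 / ((m:ℝ) + 1)) / 2 := by
    intro n m
    have h1 := clarkson μ r hr (u n) (u m)
    have h2 := hI ((1/2 : ℝ) • (u n + u m))
    have h3 := hu n
    have h4 := hu m
    simp only [hG, map_smul, map_add, smul_eq_mul] at h2 h3 h4
    linarith
  have hcau : CauchySeq u := by
    rw [Metric.cauchySeq_iff']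
    intro ε hε
    have hpos : 0 < (ε/2) ^ r := by positivity
    obtain ⟨N, hN⟩ := exists_nat_one_div_lt hpos
    refine ⟨N, fun n hn => ?_⟩
    have h1 := key n N
    have h2 : 1 / ((n:ℝ) + 1) ≤ 1 / ((N:ℝ) + 1) := by
      apply one_div_le_one_div_of_le (by positivity); have : (N:ℝ) ≤ n := by exact_mod_cast hn
      linarith
    have h3 : ‖(1/2 : ℝ) • (u n - u N)‖ ^ r < (ε/2) ^ r := by linarith
    have h4 := (Real.rpow_lt_rpow_iff (norm_nonneg _) (by positivity) h0).1 h3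
    rw [norm_smul] at h4
    rw [dist_eq_norm]
    norm_num at h4
    linarith
  obtain ⟨x, hx⟩ := cauchySeq_tendsto_of_complete hcau
  refine ⟨x, fun y => ?_⟩
  have hlim : Filter.Tendsto (fun n => G (u n)) Filter.atTop (nhds (G x)) := hGc.continuousAt.tendsto.comp hx
  have hlim2 : Filter.Tendsto (fun n : ℕ => I + 1 / ((n:ℝ) + 1)) Filter.atTop (nhds (I + 0)) :=
    tendsto_const_nhds.add tendsto_one_div_add_atTop_nhds_zero_nat
  have : G x ≤ I + 0 := le_of_tendsto_of_tendsto' hlim hlim2 fun n => (hu n).le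
  exact (by linarith [hI y] : G x ≤ G y)

lemma memLp_dual_pow {α : Type} [MeasurableSpace α] (μ : Measure α) (r r' : ℝ) (hrr : r.HolderConjugate r')
    (x : α → ℝ) (hx : MemLp x (ENNReal.ofReal r) μ) :
    MemLp (fun t => |x t| ^ (r - 2) * x t) (ENNReal.ofReal r') μ ∧
    ∫⁻ t, ‖|x t| ^ (r - 2) * x t‖ₑ ^ r' ∂μ = ∫⁻ t, ‖x t‖ₑ ^ r ∂μ := by
  have h1 : 1 < r := hrr.lt
  have h1' : 1 < r' := hrr.symm.lt
  have h0 : 0 < r := by linarith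
  have hm : AEStronglyMeasurable (fun t => |x t| ^ (r - 2) * x t) μ := by
    have := hx.1.aemeasurable
    exact ((this.abs.pow_const _).mul this).aestronglyMeasurable
  have e : ∀ t, ‖|x t| ^ (r - 2) * x t‖ₑ ^ r' = ‖x t‖ₑ ^ r := by
    intro t
    rcases eq_or_ne (x t) 0 with h | h
    · simp [h, h0, (by linarith : 0 < r')]
    · have hpos : 0 < |x t| := abs_pos.2 h
      have e1 : ‖|x t| ^ (r - 2) * x t‖ = ‖x t‖ ^ (r - 1) := by
        rw [norm_mul, Real.norm_eq_abs, Real.norm_eq_abs, abs_of_nonneg (by positivity : 0 ≤ |x t| ^ (r-2)),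
          show r - 1 = (r - 2) + 1 by ring, Real.rpow_add_one hpos.ne']
      rw [← ofReal_norm, ← ofReal_norm, e1, ENNReal.ofReal_rpow_of_nonneg (by positivity) (by linarith),
        ENNReal.ofReal_rpow_of_nonneg (by positivity) (by linarith), ← Real.rpow_mul (norm_nonneg _)]
      rw [show (r-1) * r' = r from hrr.sub_one_mul_conj]
  have hl : ∫⁻ t, ‖|x t| ^ (r - 2) * x t‖ₑ ^ r' ∂μ = ∫⁻ t, ‖x t‖ₑ ^ r ∂μ := lintegral_congr e
  refine ⟨⟨hm, ?_⟩, hl⟩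
  rw [eLpNorm_lt_top_iff_lintegral_rpow_enorm_lt_top (by simp; linarith) (by simp), ENNReal.toReal_ofReal (by linarith), hl]
  have := hx.2
  rwa [eLpNorm_lt_top_iff_lintegral_rpow_enorm_lt_top (by simp; linarith) (by simp), ENNReal.toReal_ofReal (by linarith)] at this

theorem riesz {α : Type} [MeasurableSpace α] (μ : Measure α) (r r' : ℝ) (hr : 2 ≤ r) (hrr : r.HolderConjugate r')
    [Fact (1 ≤ ENNReal.ofReal r)] (φ : Lp ℝ (ENNReal.ofReal r) μ →L[ℝ] ℝ) :
    ∃ k : α → ℝ, MemLp k (ENNReal.ofReal r') μ ∧ ∀ u : Lp ℝ (ENNReal.ofReal r) μ, φ u = ∫ t, u t * k t ∂μ := by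
  have h1 : 1 ≤ r := by linarith
  obtain ⟨x, hx⟩ := exists_min μ r hr φ
  refine ⟨fun t => r * (|x t| ^ (r - 2) * x t), (memLp_dual_pow μ r r' hrr x (Lp.memLp x)).1.const_mul r, fun y => ?_⟩
  have i := fun w : Lp ℝ (ENNReal.ofReal r) μ => integrable_rpow μ r h1 w (Lp.memLp w)
  have hxm : AEMeasurable x μ := (Lp.aestronglyMeasurable x).aemeasurable
  have hym : AEMeasurable y μ := (Lp.aestronglyMeasurable y).aemeasurable
  have hder : HasDerivAt (fun s : ℝ => ∫ t, |x t + s * y t| ^ r ∂μ) (∫ t, r * |x t + 0 * y t| ^ (r-2) * (x t + 0 * y t) * y t ∂μ) 0 := by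
    refine (hasDerivAt_integral_of_dominated_loc_of_deriv_le (s := Metric.ball 0 1) (Metric.ball_mem_nhds 0 one_pos)
      (F := fun s t => |x t + s * y t| ^ r) (F' := fun s t => r * |x t + s * y t| ^ (r-2) * (x t + s * y t) * y t)
      (bound := fun t => r * (|x t| + |y t|) ^ r) ?_ ?_ ?_ ?_ ?_ ?_).2
    · refine Filter.Eventually.of_forall fun s => ?_
      exact ((hxm.add (hym.const_mul s)).abs.pow_const _).aestronglyMeasurable
    · simpa using i x
    · exact ((((hxm.add (hym.const_mul 0)).abs.pow_const _).const_mul r).mul (hxm.add (hym.const_mul 0)) |>.mul hym).aestronglyMeasurable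
    · refine Filter.Eventually.of_forall fun t s hs => ?_
      have hs1 : |s| < 1 := by simpa using hs
      have hb : |x t + s * y t| ≤ |x t| + |y t| := by
        refine (abs_add_le _ _).trans ?_
        rw [abs_mul]
        nlinarith [abs_nonneg (y t)]
      rw [Real.norm_eq_abs, abs_mul, abs_mul, abs_mul, abs_of_nonneg (by linarith : 0 ≤ r), abs_of_nonneg (by positivity : 0 ≤ |x t + s * y t| ^ (r-2))]
      rw [mul_assoc, mul_assoc]
      have hB : 0 ≤ |x t| + |y t| := by positivity
      calc r * (|x t + s * y t| ^ (r-2) * (|x t + s * y t| * |y t|)) ≤ r * ((|x t| + |y t|) ^ (r-2) * ((|x t| + |y t|) * (|x t| + |y t|))) := by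
            gcongr
            linarith [abs_nonneg (x t)]
        _ = r * (|x t| + |y t|) ^ r := by
            rcases hB.eq_or_lt with h | h
            · rw [← h, Real.zero_rpow (by linarith : r ≠ 0)]; simp
            · congr 1
              rw [← sq, ← Real.rpow_natCast, ← Real.rpow_add h]; congr 1; push_cast; ring
    · have : MemLp (fun t => |x t| + |y t|) (ENNReal.ofReal r) μ := (Lp.memLp x).abs.add (Lp.memLp y).abs
      have := (integrable_rpow μ r h1 _ this).const_mul r
      refine this.congr (Filter.Eventually.of_forall fun t => ?_)
      simp only
      rw [abs_of_nonneg (by positivity : 0 ≤ |x t| + |y t|)]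
    · refine Filter.Eventually.of_forall fun t s hs => ?_
      have d1 := hasDerivAt_abs_rpow (x t + s * y t) (by linarith : 1 < r)
      have d2 : HasDerivAt (fun s : ℝ => x t + s * y t) (y t) s := by
        simpa using ((hasDerivAt_id s).mul_const (y t)).const_add (x t)
      exact d1.comp s d2
  have hder2 : HasDerivAt (fun s : ℝ => (∫ t, |x t + s * y t| ^ r ∂μ) - s * φ y)
      ((∫ t, r * |x t + 0 * y t| ^ (r-2) * (x t + 0 * y t) * y t ∂μ) - 1 * φ y) 0 :=
    hder.sub ((hasDerivAt_id (0:ℝ)).mul_const (φ y))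
  have hmin : IsLocalMin (fun s : ℝ => (∫ t, |x t + s * y t| ^ r ∂μ) - s * φ y) 0 := by
    refine Filter.Eventually.of_forall fun s => ?_
    have := hx (x + s • y)
    rw [norm_rpow_eq μ r h1, norm_rpow_eq μ r h1] at this
    have e : ∫ t, |(x + s • y : Lp ℝ (ENNReal.ofReal r) μ) t| ^ r ∂μ = ∫ t, |x t + s * y t| ^ r ∂μ := by
      refine integral_congr_ae ?_
      filter_upwards [Lp.coeFn_add x (s • y), Lp.coeFn_smul s y] with t a1 a2
      simp only [a1, Pi.add_apply, a2, Pi.smul_apply, smul_eq_mul]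
    rw [e] at this
    simp only [map_add, map_smul, smul_eq_mul] at this
    simp only [zero_mul, add_zero, sub_zero]
    linarith
  have := hmin.hasDerivAt_eq_zero hder2
  have e2 : φ y = ∫ t, r * |x t + 0 * y t| ^ (r-2) * (x t + 0 * y t) * y t ∂μ := by linarith
  rw [e2]
  refine integral_congr_ae (Filter.Eventually.of_forall fun t => ?_)
  simp only [zero_mul, add_zero]; ring


lemma eLpNorm_rpow_eq (P : ℝ) (hP : 0 < P) (f : ℝ → ℝ) :
    eLpNorm f (ENNReal.ofReal P) m0 ^ P = ∫⁻ t, ‖f t‖ₑ ^ P ∂m0 := by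
  rw [eLpNorm_eq_lintegral_rpow_enorm_toReal (by simpa using hP) (by simp), ENNReal.toReal_ofReal hP.le,
    ← ENNReal.rpow_mul, one_div, inv_mul_cancel₀ hP.ne', ENNReal.rpow_one]

lemma core' (P Q : ℝ) (hP : 1 < P) (hPQ : P < Q) (hP2 : P < 2) (S : V0 →ₗ[ℝ] (ℝ →ₘ[m0] ℝ))
    (C : ℝ≥0∞) (hC : C ≠ ∞)
    (h1 : ∀ f : V0, eLpNorm (S f) (ENNReal.ofReal P) m0 ≤ C * eLpNorm (f : ℝ →ₘ[m0] ℝ) (ENNReal.ofReal P) m0)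
    (h2 : ∀ f : V0, eLpNorm (S f) (ENNReal.ofReal Q) m0 ≤ C * eLpNorm (f : ℝ →ₘ[m0] ℝ) (ENNReal.ofReal P) m0)
    (h3 : ∀ f : V0, eLpNorm (f : ℝ →ₘ[m0] ℝ) (ENNReal.ofReal P) m0 ≤
      C * max (eLpNorm (S f) (ENNReal.ofReal P) m0) (eLpNorm (S f) (ENNReal.ofReal Q) m0)) : False := by
  have hP0 : 0 < P := by linarith
  have hQ0 : 0 < Q := by linarith
  have eP : ∀ f, JJ P f = eLpNorm f (ENNReal.ofReal P) m0 ^ P := fun f => (eLpNorm_rpow_eq P hP0 f).symm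
  have eQ : ∀ f, JJ Q f = eLpNorm f (ENNReal.ofReal Q) m0 ^ Q := fun f => (eLpNorm_rpow_eq Q hQ0 f).symm
  have hK : C ^ P + C ^ Q ≠ ∞ := by
    simp [ENNReal.rpow_eq_top_iff, hC, hP0.le, hQ0.le, not_lt]
  refine core P Q hP hPQ hP2 S (C ^ P + C ^ Q) (1 / (C ^ P + C ^ Q)) hK ?_ ?_ ?_ ?_
  · simp [hK]
  · intro f
    rw [eP, eP]
    calc _ ≤ (C * eLpNorm (f : ℝ →ₘ[m0] ℝ) (ENNReal.ofReal P) m0) ^ P := by gcongr; exact h1 f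
      _ = C ^ P * _ := ENNReal.mul_rpow_of_nonneg _ _ hP0.le
      _ ≤ _ := by gcongr; exact le_self_add
  · intro f
    rw [eP, eQ, ← ENNReal.rpow_mul, mul_div_cancel₀ _ hP0.ne']
    calc _ ≤ (C * eLpNorm (f : ℝ →ₘ[m0] ℝ) (ENNReal.ofReal P) m0) ^ Q := by gcongr; exact h2 f
      _ = C ^ Q * _ := ENNReal.mul_rpow_of_nonneg _ _ hQ0.le
      _ ≤ _ := by gcongr; exact le_add_self
  · intro f hf
    have hf1 : eLpNorm (f : ℝ →ₘ[m0] ℝ) (ENNReal.ofReal P) m0 = 1 := by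
      rw [eP] at hf
      rw [← ENNReal.rpow_rpow_inv hP0.ne' (eLpNorm (f : ℝ →ₘ[m0] ℝ) (ENNReal.ofReal P) m0), hf, ENNReal.one_rpow]
    have h := h3 f
    rw [hf1] at h
    rw [eP, eQ]
    rcases le_total (eLpNorm (S f) (ENNReal.ofReal P) m0) (eLpNorm (S f) (ENNReal.ofReal Q) m0) with hm | hm
    · right
      rw [max_eq_right hm] at h
      refine ENNReal.div_le_of_le_mul' ?_
      calc (1:ℝ≥0∞) = 1 ^ Q := (ENNReal.one_rpow _).symm
        _ ≤ (C * eLpNorm (S f) (ENNReal.ofReal Q) m0) ^ Q := by gcongr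
        _ = C ^ Q * _ := ENNReal.mul_rpow_of_nonneg _ _ hQ0.le
        _ ≤ _ := by gcongr; exact le_add_self
    · left
      rw [max_eq_left hm] at h
      refine ENNReal.div_le_of_le_mul' ?_
      calc (1:ℝ≥0∞) = 1 ^ P := (ENNReal.one_rpow _).symm
        _ ≤ (C * eLpNorm (S f) (ENNReal.ofReal P) m0) ^ P := by gcongr
        _ = C ^ P * _ := ENNReal.mul_rpow_of_nonneg _ _ hP0.le
        _ ≤ _ := by gcongr; exact le_self_add

lemma sumInter_symm (p q : ℝ≥0∞) (h : SumInterIsomorphic p q) : SumInterIsomorphic q p := by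
  obtain ⟨T, C, h0, h1, hT⟩ := h
  have e1 : sumSpace q p = sumSpace p q := sup_comm _ _
  have e2 : interSpace p q = interSpace q p := inf_comm _ _
  have n1 : ∀ f, sumNormE q p f = sumNormE p q f := by
    intro f
    unfold sumNormE
    rw [iInf_comm]
    refine iInf_congr fun u => iInf_congr fun v => ?_
    rw [add_comm (v : ℝ →ₘ[m0] ℝ), add_comm (eLpNorm _ q m0)]
  have n2 : ∀ f, interNormE q p f = interNormE p q f := fun f => max_comm _ _
  refine ⟨((LinearEquiv.ofEq _ _ e1).trans T).trans (LinearEquiv.ofEq _ _ e2), C, h0, h1, fun f => ?_⟩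
  have := hT (LinearEquiv.ofEq _ _ e1 f)
  rw [n1, n2]
  simpa using this

lemma V0_memLp (P : ℝ) (hP : 0 < P) (hP2 : P < 2) (f : ℝ →ₘ[m0] ℝ) (hf : f ∈ V0) :
    MemLp f (ENNReal.ofReal P) m0 := by
  refine ⟨f.aestronglyMeasurable, ?_⟩
  rw [eLpNorm_lt_top_iff_lintegral_rpow_enorm_lt_top (by simpa using hP) (by simp), ENNReal.toReal_ofReal hP.le]
  refine lt_of_le_of_lt (JJ_holder P 2 hP hP2 f hf.2) ?_
  refine ENNReal.rpow_lt_top_of_nonneg (by positivity) ?_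
  have := hf.1.2
  rw [eLpNorm_lt_top_iff_lintegral_rpow_enorm_lt_top (by simp) (by simp)] at this
  simpa [JJ] using this.ne

lemma eLpNorm_restrict_one (p : ℝ≥0∞) (f : ℝ → ℝ) (hf : ∀ᵐ x ∂m0, 1 < x → f x = 0) :
    eLpNorm f p m0 = eLpNorm f p (m0.restrict (Set.Iic 1)) := by
  rw [← eLpNorm_indicator_eq_eLpNorm_restrict measurableSet_Iic]
  refine eLpNorm_congr_ae ?_
  filter_upwards [hf] with x hx
  by_cases h : x ≤ 1
  · rw [Set.indicator_of_mem (by exact h)]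
  · rw [Set.indicator_of_notMem (by exact h), hx (not_le.1 h)]

lemma prob_one : IsProbabilityMeasure (m0.restrict (Set.Iic (1:ℝ))) :=
  ⟨by rw [Measure.restrict_apply_univ, m0_Iic_one]⟩

lemma eLpNorm_le_one (p q : ℝ≥0∞) (hpq : p ≤ q) (f : ℝ → ℝ) (hfm : AEStronglyMeasurable f m0)
    (hf : ∀ᵐ x ∂m0, 1 < x → f x = 0) : eLpNorm f p m0 ≤ eLpNorm f q m0 := by
  have := prob_one
  rw [eLpNorm_restrict_one p f hf, eLpNorm_restrict_one q f hf]
  exact eLpNorm_le_eLpNorm_of_exponent_le hpq hfm.restrict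

lemma le_sumNormE (p q : ℝ≥0∞) (hp : 1 ≤ p) (hpq : p ≤ q) (f : ℝ →ₘ[m0] ℝ) (hf : ∀ᵐ x ∂m0, 1 < x → f x = 0) :
    eLpNorm f p m0 ≤ sumNormE p q f := by
  have := prob_one
  refine le_iInf fun u => le_iInf fun v => le_iInf fun h => ?_
  rw [eLpNorm_restrict_one p f hf]
  have e : (f : ℝ → ℝ) =ᵐ[m0.restrict (Set.Iic 1)] (u : ℝ → ℝ) + (v : ℝ → ℝ) := by
    rw [h]; exact ae_restrict_of_ae (AEEqFun.coeFn_add _ _)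
  rw [eLpNorm_congr_ae e]
  refine (eLpNorm_add_le (Lp.aestronglyMeasurable u).restrict (Lp.aestronglyMeasurable v).restrict hp).trans ?_
  refine add_le_add (eLpNorm_mono_measure _ Measure.restrict_le_self) ?_
  exact (eLpNorm_le_eLpNorm_of_exponent_le hpq (Lp.aestronglyMeasurable v).restrict).trans
    (eLpNorm_mono_measure _ Measure.restrict_le_self)

lemma sumNormE_le_left (p q : ℝ≥0∞) (f : ℝ →ₘ[m0] ℝ) (hf : f ∈ Lp ℝ p m0) :
    sumNormE p q f ≤ eLpNorm f p m0 := by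
  have hz : eLpNorm ((0 : Lp ℝ q m0) : ℝ → ℝ) q m0 = 0 := by
    rw [eLpNorm_congr_ae (Lp.coeFn_zero ℝ q m0)]; exact eLpNorm_zero
  refine iInf_le_of_le (⟨f, hf⟩ : Lp ℝ p m0) (iInf_le_of_le (0 : Lp ℝ q m0) (iInf_le_of_le (by simp) ?_))
  rw [hz, add_zero]

lemma sumNormE_le_right (p q : ℝ≥0∞) (f : ℝ →ₘ[m0] ℝ) (hf : f ∈ Lp ℝ q m0) :
    sumNormE p q f ≤ eLpNorm f q m0 := by
  have hz : eLpNorm ((0 : Lp ℝ p m0) : ℝ → ℝ) p m0 = 0 := by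
    rw [eLpNorm_congr_ae (Lp.coeFn_zero ℝ p m0)]; exact eLpNorm_zero
  refine iInf_le_of_le (0 : Lp ℝ p m0) (iInf_le_of_le (⟨f, hf⟩ : Lp ℝ q m0) (iInf_le_of_le (by simp) ?_))
  rw [hz, zero_add]

lemma caseA (P Q : ℝ) (hP : 1 < P) (hPQ : P < Q) (hP2 : P < 2) :
    ¬ SumInterIsomorphic (ENNReal.ofReal P) (ENNReal.ofReal Q) := by
  rintro ⟨T, C, hC0, hC, hT⟩
  have hmem : ∀ f ∈ V0, f ∈ Lp ℝ (ENNReal.ofReal P) m0 := fun f hf =>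
    Lp.mem_Lp_iff_memLp.2 (V0_memLp P (by linarith) hP2 f hf)
  have hle : V0 ≤ sumSpace (ENNReal.ofReal P) (ENNReal.ofReal Q) := fun f hf =>
    Submodule.mem_sup_left (hmem f hf)
  refine core' P Q hP hPQ hP2
    ((interSpace (ENNReal.ofReal P) (ENNReal.ofReal Q)).subtype ∘ₗ T.toLinearMap ∘ₗ Submodule.inclusion hle) C hC.ne ?_ ?_ ?_
  · intro f
    refine le_trans (le_max_left _ _) ((hT (Submodule.inclusion hle f)).1.trans ?_)
    gcongr
    exact sumNormE_le_left _ _ _ (hmem f f.2)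
  · intro f
    refine le_trans (le_max_right _ _) ((hT (Submodule.inclusion hle f)).1.trans ?_)
    gcongr
    exact sumNormE_le_left _ _ _ (hmem f f.2)
  · intro f
    refine le_trans ?_ (hT (Submodule.inclusion hle f)).2
    exact le_sumNormE _ _ (by simpa using hP.le) (ENNReal.ofReal_le_ofReal hPQ.le) _ f.2.2


lemma holderE (r r' : ℝ) (hrr : r.HolderConjugate r') (a b : ℝ → ℝ)
    (ha : AEStronglyMeasurable a m0) (hb : AEStronglyMeasurable b m0) :
    ‖∫ t, a t * b t ∂m0‖ₑ ≤ eLpNorm a (ENNReal.ofReal r) m0 * eLpNorm b (ENNReal.ofReal r') m0 := by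
  have h0 : 0 < r := hrr.pos
  have h0' : 0 < r' := hrr.symm.pos
  refine (enorm_integral_le_lintegral_enorm _).trans ?_
  rw [eLpNorm_eq_lintegral_rpow_enorm_toReal (by simpa using h0) (by simp), ENNReal.toReal_ofReal h0.le,
    eLpNorm_eq_lintegral_rpow_enorm_toReal (by simpa using h0') (by simp), ENNReal.toReal_ofReal h0'.le]
  refine le_trans (le_of_eq ?_) (ENNReal.lintegral_mul_le_Lp_mul_Lq m0 hrr ha.enorm hb.enorm)
  refine lintegral_congr fun t => ?_
  simp [enorm_mul]

lemma integrable_dual (r r' : ℝ) (hrr : r.HolderConjugate r') (a b : ℝ → ℝ)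
    (ha : MemLp a (ENNReal.ofReal r) m0) (hb : MemLp b (ENNReal.ofReal r') m0) :
    Integrable (fun t => a t * b t) m0 := by
  have : ENNReal.HolderTriple (ENNReal.ofReal r) (ENNReal.ofReal r') 1 := by
    constructor
    rw [← ENNReal.ofReal_inv_of_pos hrr.pos, ← ENNReal.ofReal_inv_of_pos hrr.symm.pos,
      ← ENNReal.ofReal_add (by have := hrr.pos; positivity) (by have := hrr.symm.pos; positivity), hrr.inv_add_inv_eq_one]
    simp
  exact ha.integrable_mul hb

lemma cancelN (r r' : ℝ) (hrr : r.HolderConjugate r') (N D : ℝ≥0∞) (hN : N ≠ ∞)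
    (h : N ^ r' ≤ D * N ^ (r' / r)) : N ≤ D := by
  rcases eq_or_ne N 0 with h0 | h0
  · simp [h0]
  have e : N ^ r' = N * N ^ (r'/r) := by
    have : r' = 1 + r'/r := by
      have h1 := hrr.pos.ne'
      have h2 := hrr.symm.pos.ne'
      have h3 := hrr.mul_eq_add
      field_simp
      linarith
    conv_lhs => rw [this]
    rw [ENNReal.rpow_add _ _ h0 hN, ENNReal.rpow_one]
  rw [e] at h
  have hz : N ^ (r'/r) ≠ 0 := by
    simp [ENNReal.rpow_eq_zero_iff, h0, hN]
  have ht : N ^ (r'/r) ≠ ∞ := by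
    simp [ENNReal.rpow_eq_top_iff, h0, hN]
  exact (ENNReal.mul_le_mul_iff_left hz ht).1 h

lemma norming (r r' : ℝ) (hrr : r.HolderConjugate r') (k : ℝ → ℝ) (hk : MemLp k (ENNReal.ofReal r') m0) :
    ∃ x : ℝ → ℝ, MemLp x (ENNReal.ofReal r) m0 ∧
      eLpNorm x (ENNReal.ofReal r) m0 = eLpNorm k (ENNReal.ofReal r') m0 ^ (r'/r) ∧
      ‖∫ t, x t * k t ∂m0‖ₑ = eLpNorm k (ENNReal.ofReal r') m0 ^ r' ∧
      ∀ t, k t = 0 → x t = 0 := by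
  have h0 : 0 < r := hrr.pos
  have h0' : 0 < r' := hrr.symm.pos
  obtain ⟨m, l⟩ := memLp_dual_pow m0 r' r hrr.symm k hk
  refine ⟨_, m, ?_, ?_, ?_⟩
  · rw [← eLpNorm_rpow_eq r h0, ← eLpNorm_rpow_eq r' h0'] at l
    rw [div_eq_mul_inv, ENNReal.rpow_mul, ← l, ENNReal.rpow_rpow_inv h0.ne']
  · have e : ∀ t, |k t| ^ (r' - 2) * k t * k t = |k t| ^ r' := by
      intro t
      rcases eq_or_ne (k t) 0 with h | h
      · simp [h, h0'.ne']
      · rw [mul_assoc, ← sq, ← sq_abs, ← Real.rpow_natCast, ← Real.rpow_add (abs_pos.2 h)]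
        congr 1; push_cast; ring
    simp only [e]
    rw [eLpNorm_rpow_eq r' h0', Real.enorm_eq_ofReal (integral_nonneg fun t => by positivity),
      ofReal_integral_eq_lintegral_ofReal (integrable_rpow m0 r' hrr.symm.lt.le k hk)
        (Filter.Eventually.of_forall fun t => by positivity)]
    refine lintegral_congr fun t => ?_
    rw [← ofReal_norm, Real.norm_eq_abs, ENNReal.ofReal_rpow_of_nonneg (abs_nonneg _) h0'.le]
  · intro t ht
    simp [ht]

lemma rep (r r' Q Q' : ℝ) (hr : 2 ≤ r) (hrr : r.HolderConjugate r') (hQ : Q.HolderConjugate Q')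
    (A : Lp ℝ (ENNReal.ofReal r) m0 →ₗ[ℝ] (ℝ →ₘ[m0] ℝ)) (C : ℝ≥0∞) (hC : C ≠ ∞)
    (hA : ∀ u, eLpNorm (A u) (ENNReal.ofReal Q) m0 ≤ C * eLpNorm u (ENNReal.ofReal r) m0)
    (g : ℝ → ℝ) (hg : MemLp g (ENNReal.ofReal Q') m0) :
    ∃ k : ℝ →ₘ[m0] ℝ, MemLp k (ENNReal.ofReal r') m0 ∧
      (∀ u : Lp ℝ (ENNReal.ofReal r) m0, ∫ t, A u t * g t ∂m0 = ∫ t, u t * k t ∂m0) ∧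
      eLpNorm k (ENNReal.ofReal r') m0 ≤ C * eLpNorm g (ENNReal.ofReal Q') m0 := by
  have : Fact (1 ≤ ENNReal.ofReal r) := ⟨by simpa using (by linarith : 1 ≤ r)⟩
  have hAm : ∀ u, MemLp (A u) (ENNReal.ofReal Q) m0 := fun u =>
    ⟨(A u).aestronglyMeasurable, lt_of_le_of_lt (hA u) (ENNReal.mul_lt_top hC.lt_top (Lp.eLpNorm_lt_top u))⟩
  have hbd : ∀ u, ‖∫ t, A u t * g t ∂m0‖ₑ ≤ C * eLpNorm g (ENNReal.ofReal Q') m0 * eLpNorm u (ENNReal.ofReal r) m0 := by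
    intro u
    refine (holderE Q Q' hQ _ g (A u).aestronglyMeasurable hg.1).trans ?_
    calc _ ≤ C * eLpNorm u (ENNReal.ofReal r) m0 * eLpNorm g (ENNReal.ofReal Q') m0 := by gcongr; exact hA u
      _ = _ := by ring
  let φ0 : Lp ℝ (ENNReal.ofReal r) m0 →ₗ[ℝ] ℝ :=
    { toFun := fun u => ∫ t, A u t * g t ∂m0
      map_add' := by
        intro u v
        rw [← integral_add (integrable_dual Q Q' hQ _ _ (hAm u) hg) (integrable_dual Q Q' hQ _ _ (hAm v) hg)]
        refine integral_congr_ae ?_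
        rw [map_add]
        filter_upwards [AEEqFun.coeFn_add (A u) (A v)] with t ht
        rw [ht, Pi.add_apply]; ring
      map_smul' := by
        intro c u
        rw [RingHom.id_apply, smul_eq_mul, ← integral_const_mul]
        refine integral_congr_ae ?_
        rw [map_smul]
        filter_upwards [AEEqFun.coeFn_smul c (A u)] with t ht
        rw [ht, Pi.smul_apply, smul_eq_mul]; ring }
  have hD : C * eLpNorm g (ENNReal.ofReal Q') m0 ≠ ∞ := ENNReal.mul_ne_top hC hg.2.ne
  let φ : Lp ℝ (ENNReal.ofReal r) m0 →L[ℝ] ℝ := φ0.mkContinuous (C * eLpNorm g (ENNReal.ofReal Q') m0).toReal (by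
    intro u
    have := ENNReal.toReal_mono (ENNReal.mul_ne_top hD (Lp.eLpNorm_lt_top u).ne) (hbd u)
    rw [ENNReal.toReal_mul] at this
    rw [Lp.norm_def]
    rw [toReal_enorm] at this
    exact this)
  obtain ⟨k, hk, hφ⟩ := riesz m0 r r' hr hrr φ
  have hφ' : ∀ u : Lp ℝ (ENNReal.ofReal r) m0, ∫ t, A u t * g t ∂m0 = ∫ t, u t * k t ∂m0 := hφ
  have hkk := AEEqFun.coeFn_mk k hk.1
  refine ⟨AEEqFun.mk k hk.1, (memLp_congr_ae hkk).2 hk, ?_, ?_⟩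
  · intro u
    rw [hφ' u]
    refine integral_congr_ae ?_
    filter_upwards [hkk] with t ht
    rw [ht]
  · rw [eLpNorm_congr_ae hkk]
    obtain ⟨x, hx, hx1, hx2, -⟩ := norming r r' hrr k hk
    refine cancelN r r' hrr _ _ hk.2.ne ?_
    rw [← hx2, ← hx1]
    have e := hφ' (hx.toLp x)
    have e2 : ∫ t, (hx.toLp x) t * k t ∂m0 = ∫ t, x t * k t ∂m0 := by
      refine integral_congr_ae ?_
      filter_upwards [hx.coeFn_toLp] with t ht
      rw [ht]
    rw [← e2, ← e]
    refine (hbd _).trans ?_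
    rw [eLpNorm_congr_ae hx.coeFn_toLp]

lemma eq_of_int (a' b' : ℝ) (ha : 1 ≤ a') (hb : 1 ≤ b') (k l : ℝ →ₘ[m0] ℝ)
    (hk : MemLp k (ENNReal.ofReal a') m0) (hl : MemLp l (ENNReal.ofReal b') m0)
    (h : ∀ s, MeasurableSet s → m0 s < ∞ → ∫ t in s, k t ∂m0 = ∫ t in s, l t ∂m0) : k = l := by
  have : SigmaFinite m0 := by unfold m0; infer_instance
  apply AEEqFun.ext
  refine ae_eq_of_forall_setIntegral_eq_of_sigmaFinite ?_ ?_ h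
  · intro s hs hm
    have : IsFiniteMeasure (m0.restrict s) := ⟨by simpa using hm⟩
    exact (hk.restrict s).integrable (by simpa using ha)
  · intro s hs hm
    have : IsFiniteMeasure (m0.restrict s) := ⟨by simpa using hm⟩
    exact (hl.restrict s).integrable (by simpa using hb)

lemma int_ind (p : ℝ≥0∞) (s : Set ℝ) (hs : MeasurableSet s) (hm : m0 s ≠ ∞) (k : ℝ → ℝ) :
    ∫ t, (indicatorConstLp p hs hm (1:ℝ) : ℝ → ℝ) t * k t ∂m0 = ∫ t in s, k t ∂m0 := by
  rw [← integral_indicator hs]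
  refine integral_congr_ae ?_
  filter_upwards [indicatorConstLp_coeFn (p := p) (hs := hs) (hμs := hm) (c := (1:ℝ))] with t ht
  rw [ht]
  by_cases h : t ∈ s <;> simp [h]


def iL (p q : ℝ≥0∞) : Lp ℝ p m0 →ₗ[ℝ] sumSpace p q where
  toFun u := ⟨(u : ℝ →ₘ[m0] ℝ), Submodule.mem_sup_left u.2⟩
  map_add' _ _ := rfl
  map_smul' _ _ := rfl

def iR (p q : ℝ≥0∞) : Lp ℝ q m0 →ₗ[ℝ] sumSpace p q where
  toFun u := ⟨(u : ℝ →ₘ[m0] ℝ), Submodule.mem_sup_right u.2⟩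
  map_add' _ _ := rfl
  map_smul' _ _ := rfl

lemma caseB (P Q P' Q' : ℝ) (hP2 : 2 ≤ P) (hPQ : P < Q) (hP : P.HolderConjugate P') (hQ : Q.HolderConjugate Q') :
    ¬ SumInterIsomorphic (ENNReal.ofReal P) (ENNReal.ofReal Q) := by
  set p := ENNReal.ofReal P with hp
  set q := ENNReal.ofReal Q with hq
  rintro ⟨T, C, hC0, hC, hT⟩
  have hQP' : Q' < P' := by
    rw [hP.conjugate_eq, hQ.conjugate_eq, div_lt_div_iff₀ (by linarith) (by linarith)]
    nlinarith
  have hQ'2 : Q' < 2 := by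
    rw [hQ.conjugate_eq, div_lt_iff₀ (by linarith)]; linarith
  have hQ'1 : 1 < Q' := hQ.symm.lt
  have hP'1 : 1 < P' := hP.symm.lt
  let A : sumSpace p q →ₗ[ℝ] (ℝ →ₘ[m0] ℝ) := (interSpace p q).subtype ∘ₗ T.toLinearMap
  have hA : ∀ f : sumSpace p q, eLpNorm (A f) q m0 ≤ C * sumNormE p q f := fun f =>
    le_trans (le_max_right _ _) (hT f).1
  have hAm : ∀ f : sumSpace p q, MemLp (A f) q m0 := fun f => Lp.mem_Lp_iff_memLp.1 (T f).2.2
  have hAL : ∀ u, eLpNorm ((A ∘ₗ iL p q) u) q m0 ≤ C * eLpNorm u p m0 := by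
    intro u
    refine (hA _).trans ?_
    gcongr
    exact sumNormE_le_left p q _ u.2
  have hAR : ∀ u, eLpNorm ((A ∘ₗ iR p q) u) q m0 ≤ C * eLpNorm u q m0 := by
    intro u
    refine (hA _).trans ?_
    gcongr
    exact sumNormE_le_right p q _ u.2
  have hgm : ∀ g : V0, MemLp (g : ℝ →ₘ[m0] ℝ) (ENNReal.ofReal Q') m0 := fun g =>
    V0_memLp Q' (by linarith) hQ'2 g g.2
  have ex : ∀ g : V0, ∃ k : ℝ →ₘ[m0] ℝ, MemLp k (ENNReal.ofReal P') m0 ∧ MemLp k (ENNReal.ofReal Q') m0 ∧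
      (∀ u : Lp ℝ p m0, ∫ t, A (iL p q u) t * (g : ℝ →ₘ[m0] ℝ) t ∂m0 = ∫ t, u t * k t ∂m0) ∧
      (∀ u : Lp ℝ q m0, ∫ t, A (iR p q u) t * (g : ℝ →ₘ[m0] ℝ) t ∂m0 = ∫ t, u t * k t ∂m0) ∧
      eLpNorm k (ENNReal.ofReal P') m0 ≤ C * eLpNorm (g : ℝ →ₘ[m0] ℝ) (ENNReal.ofReal Q') m0 ∧
      eLpNorm k (ENNReal.ofReal Q') m0 ≤ C * eLpNorm (g : ℝ →ₘ[m0] ℝ) (ENNReal.ofReal Q') m0 := by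
    intro g
    obtain ⟨k, k1, k2, k3⟩ := rep P P' Q Q' hP2 hP hQ (A ∘ₗ iL p q) C hC.ne hAL g (hgm g)
    obtain ⟨l, l1, l2, l3⟩ := rep Q Q' Q Q' (by linarith) hQ hQ (A ∘ₗ iR p q) C hC.ne hAR g (hgm g)
    have hkl : k = l := by
      refine eq_of_int P' Q' hP'1.le hQ'1.le k l k1 l1 fun s hs hm => ?_
      rw [← int_ind p s hs hm.ne, ← int_ind q s hs hm.ne]
      have a1 := k2 (indicatorConstLp p hs hm.ne (1:ℝ))
      have a2 := l2 (indicatorConstLp q hs hm.ne (1:ℝ))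
      rw [← a1, ← a2]
      rfl
    subst hkl
    exact ⟨k, k1, l1, k2, l2, k3, l3⟩
  choose k k1 k2 k3 k4 k5 k6 using ex
  have test : ∀ (g : V0) (s : Set ℝ) (hs : MeasurableSet s) (hm : m0 s < ∞),
      ∫ t in s, k g t ∂m0 = ∫ t, A (iL p q (indicatorConstLp p hs hm.ne (1:ℝ))) t * (g : ℝ →ₘ[m0] ℝ) t ∂m0 := by
    intro g s hs hm
    rw [k3, int_ind]
  have hAgInt : ∀ (f : sumSpace p q) (g : V0), Integrable (fun t => A f t * (g : ℝ →ₘ[m0] ℝ) t) m0 := fun f g =>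
    integrable_dual Q Q' hQ _ _ (hAm f) (hgm g)
  have hki : ∀ (g : V0) (s : Set ℝ), m0 s < ∞ → Integrable (k g) (m0.restrict s) := by
    intro g s hm
    have : IsFiniteMeasure (m0.restrict s) := ⟨by simpa using hm⟩
    exact ((k1 g).restrict s).integrable (by simpa using hP'1.le)
  let S : V0 →ₗ[ℝ] (ℝ →ₘ[m0] ℝ) :=
    { toFun := k
      map_add' := by
        intro f g
        have c0 := AEEqFun.coeFn_add (k f) (k g)
        refine eq_of_int P' P' hP'1.le hP'1.le _ _ (k1 _) ((memLp_congr_ae c0).2 ((k1 f).add (k1 g))) fun s hs hm => ?_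
        rw [integral_congr_ae (ae_restrict_of_ae c0)]
        simp only [Pi.add_apply]
        rw [integral_add (hki f s hm) (hki g s hm), test _ s hs hm, test _ s hs hm, test _ s hs hm,
          ← integral_add (hAgInt _ _) (hAgInt _ _)]
        refine integral_congr_ae ?_
        filter_upwards [AEEqFun.coeFn_add (f : ℝ →ₘ[m0] ℝ) (g : ℝ →ₘ[m0] ℝ)] with t ht
        rw [Submodule.coe_add, ht, Pi.add_apply]; ring
      map_smul' := by
        intro c f
        have c0 := AEEqFun.coeFn_smul c (k f)
        refine eq_of_int P' P' hP'1.le hP'1.le _ _ (k1 _) ((memLp_congr_ae c0).2 ((k1 f).const_smul c)) fun s hs hm => ?_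
        rw [RingHom.id_apply, integral_congr_ae (ae_restrict_of_ae c0)]
        simp only [Pi.smul_apply, smul_eq_mul]
        rw [integral_const_mul, test _ s hs hm, test _ s hs hm, ← integral_const_mul]
        refine integral_congr_ae ?_
        filter_upwards [AEEqFun.coeFn_smul c (f : ℝ →ₘ[m0] ℝ)] with t ht
        rw [Submodule.coe_smul, ht, Pi.smul_apply, smul_eq_mul]; ring }
  have h2C : (2:ℝ≥0∞) * C ≠ ∞ := ENNReal.mul_ne_top (by simp) hC.ne
  have hC2 : C ≤ 2 * C := by rw [two_mul]; exact le_self_add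
  refine core' Q' P' hQ'1 hQP' hQ'2 S (2 * C) h2C ?_ ?_ ?_
  · intro g
    exact (k6 g).trans (by gcongr)
  · intro g
    exact (k5 g).trans (by gcongr)
  · intro g
    change _ ≤ 2 * C * max (eLpNorm (k g) _ m0) (eLpNorm (k g) _ m0)
    set N := eLpNorm (g : ℝ →ₘ[m0] ℝ) (ENNReal.ofReal Q') m0 with hN
    have hNt : N ≠ ∞ := (hgm g).2.ne
    rcases eq_or_ne N 0 with hN0 | hN0
    · rw [hN0]; exact zero_le
    set M := max (eLpNorm (k g) (ENNReal.ofReal Q') m0) (eLpNorm (k g) (ENNReal.ofReal P') m0) with hM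
    obtain ⟨x, hx, hx1, hx2, hx3⟩ := norming Q Q' hQ g (hgm g)
    have hxv : ∀ᵐ t ∂m0, 1 < t → x t = 0 := by
      filter_upwards [g.2.2] with t ht h using hx3 t (ht h)
    have hxp : eLpNorm x p m0 ≤ eLpNorm x q m0 :=
      eLpNorm_le_one p q (ENNReal.ofReal_le_ofReal hPQ.le) x hx.1 hxv
    have hxpm : MemLp x p m0 := ⟨hx.1, lt_of_le_of_lt hxp hx.2⟩
    have cx := AEEqFun.coeFn_mk x hx.1
    let X : interSpace p q := ⟨AEEqFun.mk x hx.1,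
      Lp.mem_Lp_iff_memLp.2 ((memLp_congr_ae cx).2 hxpm), Lp.mem_Lp_iff_memLp.2 ((memLp_congr_ae cx).2 hx)⟩
    have hAX : A (T.symm X) = AEEqFun.mk x hx.1 := by
      simp [A, X]
    have hxpos : eLpNorm x q m0 ≠ 0 := by
      rw [hx1]; simp [ENNReal.rpow_eq_zero_iff, hN0, hNt, ← hN]
    have hlt : sumNormE p q (T.symm X) < 2 * C * eLpNorm x q m0 := by
      have h1 := (hT (T.symm X)).2
      rw [LinearEquiv.apply_symm_apply] at h1
      have h2 : interNormE p q X ≤ eLpNorm x q m0 := by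
        unfold interNormE
        change max (eLpNorm (AEEqFun.mk x hx.1) p m0) (eLpNorm (AEEqFun.mk x hx.1) q m0) ≤ _
        rw [eLpNorm_congr_ae cx, eLpNorm_congr_ae cx]
        exact max_le hxp le_rfl
      refine lt_of_le_of_lt (h1.trans (mul_le_mul_right h2 C)) ?_
      rw [mul_assoc, two_mul]
      exact ENNReal.lt_add_right (ENNReal.mul_ne_top hC.ne hx.2.ne) (mul_ne_zero hC0.ne' hxpos)
    unfold sumNormE at hlt
    simp only [iInf_lt_iff] at hlt
    obtain ⟨u, v, huv, hlt⟩ := hlt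
    have hy : T.symm X = iL p q u + iR p q v := Subtype.ext huv
    have e1 : ∫ t, x t * (g : ℝ →ₘ[m0] ℝ) t ∂m0 = ∫ t, u t * k g t ∂m0 + ∫ t, v t * k g t ∂m0 := by
      rw [← k3, ← k4, ← integral_add (hAgInt _ _) (hAgInt _ _)]
      refine integral_congr_ae ?_
      have h3 : AEEqFun.mk x hx.1 = A (iL p q u) + A (iR p q v) := by
        rw [← hAX, hy, map_add]
      have h4 := AEEqFun.coeFn_add (A (iL p q u)) (A (iR p q v))
      rw [← h3] at h4
      filter_upwards [h4, cx] with t a1 a2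
      rw [← a2, a1, Pi.add_apply]; ring
    refine cancelN Q Q' hQ N _ hNt ?_
    rw [← hx1, ← hx2, e1]
    calc _ ≤ ‖∫ t, u t * k g t ∂m0‖ₑ + ‖∫ t, v t * k g t ∂m0‖ₑ := enorm_add_le _ _
      _ ≤ eLpNorm u p m0 * M + eLpNorm v q m0 * M := by
        refine add_le_add ?_ ?_
        · refine (holderE P P' hP _ _ (Lp.aestronglyMeasurable u) (k g).aestronglyMeasurable).trans ?_
          gcongr
          exact le_max_right _ _
        · refine (holderE Q Q' hQ _ _ (Lp.aestronglyMeasurable v) (k g).aestronglyMeasurable).trans ?_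
          gcongr
          exact le_max_left _ _
      _ = (eLpNorm u p m0 + eLpNorm v q m0) * M := by ring
      _ ≤ (2 * C * eLpNorm x q m0) * M := by gcongr
      _ = _ := by ring

lemma final_lt (p q : ℝ≥0∞) (hp : 1 < p) (hp' : p ≠ ∞) (hq' : q ≠ ∞) (hpq : p < q) : ¬ SumInterIsomorphic p q := by
  have h1 : 1 < p.toReal := by
    simpa using (ENNReal.toReal_lt_toReal (by simp) hp').2 hp
  have h2 : p.toReal < q.toReal := (ENNReal.toReal_lt_toReal hp' hq').2 hpq
  rw [← ENNReal.ofReal_toReal hp', ← ENNReal.ofReal_toReal hq']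
  rcases lt_or_ge p.toReal 2 with h | h
  · exact caseA _ _ h1 h2 h
  · exact caseB _ _ _ _ h h2 (Real.HolderConjugate.conjExponent h1) (Real.HolderConjugate.conjExponent (h1.trans h2))

/-- **Statement 4.** For all `1 < p, q < ∞` with `p ≠ q`, the Banach spaces `L_p + L_q` and
`L_p ∩ L_q` on `(0, ∞)` are not isomorphic. -/
theorem Lp_add_Lq_not_isomorphic_Lp_inter_Lq (p q : ℝ≥0∞) (hp : 1 < p) (hp' : p ≠ ∞)
    (hq : 1 < q) (hq' : q ≠ ∞) (hpq : p ≠ q) :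
    ¬ SumInterIsomorphic p q := by
  rcases lt_or_gt_of_ne hpq with h | h
  · exact final_lt p q hp hp' hq' h
  · exact fun hs => final_lt q p hq hq' hp' h (sumInter_symm p q hs)
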